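/- Let H be a nonbipartite, edge-critical, strictly 2-balanced graph with v_H vertices, e_H edges and χ(H) = r+1, and let ε > 0. Suppose p = p(n) satisfies (1+ε)·θ_H·n^{−1/m₂(H)}·(log n)^{1/(e_H−1)} ≤ p ≤ 1 for all large n. Then for every constant δ > 0, asymptotically almost surely G ~ G_{n,p} has the following property: for every H-free subgraph F of G with the maximum number of edges, every r-cut Π of the vertex set maximizing the number of edges of F in ext(Π) is δ-balanced. -/

import Mathlib

open MeasureTheory Filter Topology

noncomputable def bern (p : ℝ) : Measure Bool :=
  (ENNReal.ofReal p) • Measure.dirac true + (ENNReal.ofReal (1 - p)) • Measure.dirac false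

noncomputable def gnp (n : ℕ) (p : ℝ) : Measure (Sym2 (Fin n) → Bool) :=
  Measure.pi fun _ => bern p

/-- The binomial random graph `G_{n,p}`, as a function of the Bernoulli sample `ω`. -/
def graphOf {n : ℕ} (ω : Sym2 (Fin n) → Bool) : SimpleGraph (Fin n) :=
  SimpleGraph.fromEdgeSet {e | ω e = true}

/-- `G` contains a subgraph isomorphic to `H`. -/
def Contains {α β : Type*} (H : SimpleGraph α) (G : SimpleGraph β) : Prop :=
  ∃ f : H →g G, Function.Injective f

/-- `H` is edge-critical: deleting some edge decreases the chromatic number. -/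
def EdgeCritical {α : Type*} (H : SimpleGraph α) : Prop :=
  ∃ e ∈ H.edgeSet, (H.deleteEdges {e}).chromaticNumber < H.chromaticNumber

/-- The 2-density `m₂(H)`. -/
noncomputable def twoDensity {α : Type*} (H : SimpleGraph α) : ℝ :=
  sSup {x : ℝ | ∃ F : H.Subgraph, 2 ≤ Nat.card F.edgeSet ∧
    x = ((Nat.card F.edgeSet : ℝ) - 1) / ((Nat.card F.verts : ℝ) - 2)}

/-- `H` is strictly 2-balanced: the maximum in the definition of `m₂(H)` is attained
only at `H` itself. -/
def StrictlyTwoBalanced {α : Type*} (H : SimpleGraph α) : Prop :=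
  ∀ F : H.Subgraph, 2 ≤ Nat.card F.edgeSet → F ≠ ⊤ →
    ((Nat.card F.edgeSet : ℝ) - 1) / ((Nat.card F.verts : ℝ) - 2) < twoDensity H

/-- The number of subgraphs of `G` isomorphic to `H`. -/
noncomputable def copyCount {α β : Type*} (H : SimpleGraph α) (G : SimpleGraph β) : ℕ :=
  Nat.card {F : G.Subgraph // Nonempty (H ≃g F.coe)}

/-- The complete balanced `r`-partite graph with parts of size `m`, together with one
additional edge inside the first part (joining its first two vertices). -/
def KrmPlus (r m : ℕ) : SimpleGraph (Fin r × Fin m) :=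
  SimpleGraph.fromRel fun u v =>
    u.1 ≠ v.1 ∨ (u.1.val = 0 ∧ v.1.val = 0 ∧ u.2.val = 0 ∧ v.2.val = 1)

/-- `ext(Π)`: the pairs of vertices meeting two distinct parts. -/
def extPairs {ι α : Type*} (S : ι → Set α) : Set (Sym2 α) :=
  {e | ∃ u v, e = s(u, v) ∧ ∃ i j, i ≠ j ∧ u ∈ S i ∧ v ∈ S j}

/-- An (ordered) `r`-cut: a partition of the vertex set into `r` parts. -/
def IsCut {n r : ℕ} (P : Fin r → Finset (Fin n)) : Prop :=
  (∀ i j, i ≠ j → Disjoint (P i) (P j)) ∧ ∀ v : Fin n, ∃ i, v ∈ P i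

/-- A `δ`-balanced tuple: every part has size between `(1-δ)n/r` and `(1+δ)n/r`. -/
def IsBalancedCut (δ : ℝ) {n r : ℕ} (P : Fin r → Finset (Fin n)) : Prop :=
  ∀ i, (1 - δ) * n / r ≤ ((P i).card : ℝ) ∧ ((P i).card : ℝ) ≤ (1 + δ) * n / r

/-- The number of edges of `G` crossing the cut `P`. -/
noncomputable def cutCount {n r : ℕ} (G : SimpleGraph (Fin n)) (P : Fin r → Finset (Fin n)) : ℕ :=
  Nat.card (G.edgeSet ∩ extPairs (fun i => (↑(P i) : Set (Fin n))) : Set (Sym2 (Fin n)))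

/-- `I` is covered by few pairs `(S, C)`, meaning `S ⊆ I` and `I \ S ⊆ C`, whenever `P I` holds;
here all the `S` are small, their number is controlled by a generating function, and all the `C`
satisfy `Q`. -/
def ContainerCover {α : Type*} [Fintype α] [DecidableEq α] (L : ℕ) (s : ℝ)
    (P Q : Finset α → Prop) : Prop :=
  ∃ 𝒞 : Finset (Finset α × Finset α),
    (∀ I, P I → ∃ x ∈ 𝒞, x.1 ⊆ I ∧ I \ x.1 ⊆ x.2) ∧
    (∀ x ∈ 𝒞, (x.1.card : ℝ) ≤ L * s ∧ Q x.2) ∧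
    ∀ y : ℝ, 0 ≤ y → ∑ x ∈ 𝒞, y ^ x.1.card ≤ (1 + y) ^ (L * Fintype.card α)

theorem sum_image_le_sum {ι κ : Type*} [DecidableEq κ] (s : Finset ι) (g : ι → κ) (f : κ → ℝ)
    (hf : ∀ b, 0 ≤ f b) : ∑ b ∈ s.image g, f b ≤ ∑ a ∈ s, f (g a) := by
  rw [Finset.sum_comp f g]
  refine Finset.sum_le_sum fun b hb => ?_
  obtain ⟨a, ha, rfl⟩ := Finset.mem_image.1 hb
  have : 0 < (s.filter fun a' => g a' = g a).card :=
    Finset.card_pos.2 ⟨a, Finset.mem_filter.2 ⟨ha, rfl⟩⟩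
  rw [nsmul_eq_mul]
  exact le_mul_of_one_le_left (hf _) (by exact_mod_cast this)

section Cover

variable {α : Type*} [Fintype α] [DecidableEq α]

theorem ContainerCover.mono {L L' : ℕ} {s : ℝ} {P P' Q Q' : Finset α → Prop} (hs : 0 ≤ s)
    (h : ContainerCover L s P Q) (hL : L ≤ L') (hP : ∀ I, P' I → P I) (hQ : ∀ C, Q C → Q' C) :
    ContainerCover L' s P' Q' := by
  obtain ⟨𝒞, h1, h2, h3⟩ := h
  refine ⟨𝒞, fun I hI => h1 I (hP I hI), fun x hx => ⟨(h2 x hx).1.trans ?_, hQ _ (h2 x hx).2⟩,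
    fun y hy => (h3 y hy).trans ?_⟩
  · gcongr
  · gcongr
    linarith

theorem containerCover_singleton {L : ℕ} {s : ℝ} {P Q : Finset α → Prop} (hs : 0 ≤ s)
    (C : Finset α) (hP : ∀ I, P I → I ⊆ C) (hQ : Q C) : ContainerCover L s P Q := by
  refine ⟨{(∅, C)}, fun I hI => ⟨(∅, C), by simp, by simp, by simpa using hP I hI⟩, ?_, ?_⟩
  · simp only [Finset.mem_singleton, forall_eq, Finset.card_empty, Nat.cast_zero]
    exact ⟨by positivity, hQ⟩
  · intro y hy
    simpa using one_le_pow₀ (by linarith)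

theorem ContainerCover.bind {L L' : ℕ} {s : ℝ} {P Q' : Finset α → Prop}
    (𝒜 : Finset (Finset α × Finset α)) (R : Finset α × Finset α → Finset α → Prop)
    (hcov : ∀ I, P I → ∃ x ∈ 𝒜, x.1 ⊆ I ∧ R x (I \ x.1))
    (hcard : ∀ x ∈ 𝒜, (x.1.card : ℝ) ≤ L * s)
    (hw : ∀ y : ℝ, 0 ≤ y → ∑ x ∈ 𝒜, y ^ x.1.card ≤ (1 + y) ^ (L * Fintype.card α))
    (hR : ∀ x ∈ 𝒜, ContainerCover L' s (R x) Q') : ContainerCover (L + L') s P Q' := by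
  have hR' : ∀ x, ∃ 𝒞 : Finset (Finset α × Finset α), x ∈ 𝒜 →
    (∀ I, R x I → ∃ x ∈ 𝒞, x.1 ⊆ I ∧ I \ x.1 ⊆ x.2) ∧
    (∀ x ∈ 𝒞, (x.1.card : ℝ) ≤ L' * s ∧ Q' x.2) ∧
    ∀ y : ℝ, 0 ≤ y → ∑ x ∈ 𝒞, y ^ x.1.card ≤ (1 + y) ^ (L' * Fintype.card α) := by
    intro x
    by_cases hx : x ∈ 𝒜
    · obtain ⟨𝒞, h⟩ := hR x hx
      exact ⟨𝒞, fun _ => h⟩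
    · exact ⟨∅, fun h => absurd h hx⟩
  choose 𝒞 h𝒞 using hR'
  refine ⟨(𝒜.sigma fun x => (𝒞 x).filter fun z => Disjoint x.1 z.1).image
    fun w => (w.1.1 ∪ w.2.1, w.2.2), ?_, ?_, ?_⟩
  · intro I hI
    obtain ⟨x, hx, hxI, hRx⟩ := hcov I hI
    obtain ⟨z, hz, hz1, hz2⟩ := (h𝒞 x hx).1 _ hRx
    refine ⟨(x.1 ∪ z.1, z.2), ?_, ?_, ?_⟩
    · simp only [Finset.mem_image, Finset.mem_sigma, Finset.mem_filter]
      exact ⟨⟨x, z⟩, ⟨hx, hz, (Finset.disjoint_sdiff).mono_right hz1⟩, rfl⟩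
    · exact Finset.union_subset hxI (hz1.trans Finset.sdiff_subset)
    · intro a ha
      apply hz2
      simp only [Finset.mem_sdiff, Finset.mem_union] at ha ⊢
      tauto
  · intro w hw
    simp only [Finset.mem_image, Finset.mem_sigma, Finset.mem_filter] at hw
    obtain ⟨⟨x, z⟩, ⟨hx, hz, hd⟩, rfl⟩ := hw
    refine ⟨?_, ((h𝒞 x hx).2.1 z hz).2⟩
    simp only [Finset.card_union_of_disjoint hd]
    push_cast
    have := hcard x hx
    have := ((h𝒞 x hx).2.1 z hz).1
    linarith
  · intro y hy
    calc _ ≤ ∑ x ∈ 𝒜, ∑ z ∈ (𝒞 x).filter (fun z => Disjoint x.1 z.1), y ^ (x.1 ∪ z.1).card := by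
          rw [Finset.sum_sigma']
          exact sum_image_le_sum _ _ (fun w : Finset α × Finset α => y ^ w.1.card) (fun _ => by positivity)
      _ ≤ ∑ x ∈ 𝒜, y ^ x.1.card * ∑ z ∈ 𝒞 x, y ^ z.1.card := by
          gcongr with x hx
          rw [Finset.mul_sum]
          calc _ = ∑ z ∈ (𝒞 x).filter (fun z => Disjoint x.1 z.1), y ^ x.1.card * y ^ z.1.card := by
                apply Finset.sum_congr rfl
                intro z hz
                rw [Finset.card_union_of_disjoint (Finset.mem_filter.1 hz).2, pow_add]
            _ ≤ _ := Finset.sum_le_sum_of_subset_of_nonneg (Finset.filter_subset _ _)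
                (by intros; positivity)
      _ ≤ ∑ x ∈ 𝒜, y ^ x.1.card * (1 + y) ^ (L' * Fintype.card α) := by
          gcongr with x hx
          exact (h𝒞 x hx).2.2 y hy
      _ ≤ _ := by
          rw [← Finset.sum_mul, add_mul, pow_add]
          gcongr
          exact hw y hy

end Cover

/-- The total weight of the supersets of `T`. -/
def weightDegree {α : Type*} [Fintype α] [DecidableEq α] (μ : Finset α → ℝ) (T : Finset α) : ℝ :=
  ∑ E with T ⊆ E, μ E

/-- A weighted `k`-uniform hypergraph whose degrees are well spread. -/
structure IsSpread {α : Type*} [Fintype α] [DecidableEq α] (K τ N : ℝ) (k : ℕ)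
    (μ : Finset α → ℝ) : Prop where
  nonneg : ∀ E, 0 ≤ μ E
  card_eq : ∀ E, μ E ≠ 0 → E.card = k
  degree_le : ∀ T : Finset α, T.Nonempty → weightDegree μ T ≤ K * τ ^ (T.card - 1) / N

section Spread

variable {α : Type*} [Fintype α] [DecidableEq α]

theorem weightDegree_nonneg {μ : Finset α → ℝ} (h : ∀ E, 0 ≤ μ E) (T : Finset α) :
    0 ≤ weightDegree μ T := Finset.sum_nonneg fun _ _ => h _

theorem sum_le_sum_weightDegree {μ : Finset α → ℝ} (h : ∀ E, 0 ≤ μ E) (𝒯 : Finset (Finset α))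
    (s : Finset (Finset α)) (hs : ∀ E ∈ s, μ E ≠ 0 → ∃ T ∈ 𝒯, T ⊆ E) :
    ∑ E ∈ s, μ E ≤ ∑ T ∈ 𝒯, weightDegree μ T := by
  unfold weightDegree
  simp_rw [Finset.sum_filter]
  rw [Finset.sum_comm]
  calc ∑ E ∈ s, μ E ≤ ∑ E ∈ s, ∑ T ∈ 𝒯, if T ⊆ E then μ E else 0 := by
        refine Finset.sum_le_sum fun E hE => ?_
        by_cases h0 : μ E = 0
        · simp [h0]
        obtain ⟨T, hT, hTE⟩ := hs E hE h0
        calc μ E = if T ⊆ E then μ E else 0 := by simp [hTE]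
          _ ≤ _ := Finset.single_le_sum (f := fun T => if T ⊆ E then μ E else 0)
            (fun T _ => by split_ifs <;> simp [h]) hT
    _ ≤ _ := Finset.sum_le_sum_of_subset_of_nonneg (Finset.subset_univ _)
        fun E _ _ => Finset.sum_nonneg fun T _ => by split_ifs <;> simp [h]

theorem IsSpread.sum_meeting_le {K τ N : ℝ} {k : ℕ} {μ : Finset α → ℝ} (h : IsSpread K τ N k μ)
    (D : Finset α) (s : Finset (Finset α)) (hs : ∀ E ∈ s, μ E ≠ 0 → ∃ v ∈ D, v ∈ E) :
    ∑ E ∈ s, μ E ≤ D.card * (K / N) := by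
  calc _ ≤ ∑ T ∈ D.image (fun v => ({v} : Finset α)), weightDegree μ T := by
        apply sum_le_sum_weightDegree h.nonneg
        intro E hE h0
        obtain ⟨v, hv, hvE⟩ := hs E hE h0
        exact ⟨{v}, Finset.mem_image_of_mem _ hv, by simpa using hvE⟩
    _ = ∑ v ∈ D, weightDegree μ {v} := Finset.sum_image (by simp)
    _ ≤ ∑ v ∈ D, K / N := by
        gcongr with v hv
        simpa using h.degree_le {v} (by simp)
    _ = _ := by simp

theorem IsSpread.sum_le {K τ N : ℝ} {k : ℕ} {μ : Finset α → ℝ} (h : IsSpread K τ N (k + 1) μ)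
    (hK : 0 ≤ K) (hN : 0 < N) (hcard : (Fintype.card α : ℝ) ≤ N) : ∑ E, μ E ≤ K := by
  calc _ ≤ (Finset.univ : Finset α).card * (K / N) := by
        apply h.sum_meeting_le
        intro E _ hE
        have := h.card_eq E hE
        obtain ⟨v, hv⟩ := Finset.card_pos.1 (by omega : 0 < E.card)
        exact ⟨v, by simp, hv⟩
    _ ≤ N * (K / N) := by
        gcongr
        simpa using hcard
    _ = K := by field_simp

/-- The well spread weights supported on the links of the vertices of `F`. -/
def linkWeights (K τ N : ℝ) (k : ℕ) (μ : Finset α → ℝ) (F : Finset α) : Set (Finset α → ℝ) :=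
  {ν | IsSpread K τ N k ν ∧ ∀ E, ν E ≠ 0 → ∃ v ∈ F, v ∉ E ∧ μ (insert v E) ≠ 0}

theorem exists_isMaxOn_linkWeights {K τ N : ℝ} (hK : 0 ≤ K) (hτ : 0 ≤ τ) (hN : 0 < N)
    (hcard : (Fintype.card α : ℝ) ≤ N) (k : ℕ) (μ : Finset α → ℝ) (F : Finset α) :
    ∃ ν ∈ linkWeights K τ N (k + 1) μ F,
      ∀ ν' ∈ linkWeights K τ N (k + 1) μ F, ∑ E, ν' E ≤ ∑ E, ν E := by
  have hcl : IsClosed (linkWeights K τ N (k + 1) μ F) := by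
    have : linkWeights K τ N (k + 1) μ F = {ν | (∀ E, 0 ≤ ν E) ∧
        (∀ E, ¬ (E.card = k + 1 ∧ ∃ v ∈ F, v ∉ E ∧ μ (insert v E) ≠ 0) → ν E = 0) ∧
        ∀ T : Finset α, T.Nonempty → weightDegree ν T ≤ K * τ ^ (T.card - 1) / N} := by
      ext ν
      constructor
      · rintro ⟨h1, h2⟩
        refine ⟨h1.nonneg, fun E hE => ?_, h1.degree_le⟩
        by_contra h0
        exact hE ⟨h1.card_eq E h0, h2 E h0⟩
      · rintro ⟨h1, h2, h3⟩
        refine ⟨⟨h1, fun E hE => ?_, h3⟩, fun E hE => ?_⟩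
        · by_contra h0
          exact hE (h2 E fun h => h0 h.1)
        · by_contra h0
          exact hE (h2 E fun h => h0 h.2)
    rw [this]
    simp only [Set.ofPred_and, Set.ofPred_forall]
    refine IsClosed.inter (isClosed_iInter fun E => ?_) (IsClosed.inter
      (isClosed_iInter fun E => isClosed_iInter fun _ => ?_)
      (isClosed_iInter fun T => isClosed_iInter fun _ => ?_))
    · exact isClosed_le continuous_const (continuous_apply E)
    · exact isClosed_eq (continuous_apply E) continuous_const
    · unfold weightDegree
      exact isClosed_le (by fun_prop) continuous_const
  have hsub : linkWeights K τ N (k + 1) μ F ⊆ Set.Icc 0 (fun _ => K) := by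
    intro ν hν
    refine ⟨fun E => hν.1.nonneg E, fun E => ?_⟩
    exact (Finset.single_le_sum (fun E _ => hν.1.nonneg E) (Finset.mem_univ E)).trans
      (hν.1.sum_le hK hN hcard)
  have hcomp : IsCompact (linkWeights K τ N (k + 1) μ F) := isCompact_Icc.of_isClosed_subset hcl hsub
  have hne : (linkWeights K τ N (k + 1) μ F).Nonempty :=
    ⟨0, ⟨by simp, by simp, fun T _ => by simp [weightDegree]; positivity⟩, by simp⟩
  obtain ⟨ν, hν, hmax⟩ := hcomp.exists_isMaxOn hne (f := fun ν => ∑ E, ν E)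
    (by fun_prop)
  exact ⟨ν, hν, fun ν' hν' => hmax hν'⟩

end Spread

section Level

variable {α : Type*} [Fintype α] [DecidableEq α]

theorem sum_weightDegree {k : ℕ} {ν : Finset α → ℝ} (hν : ∀ E, ν E ≠ 0 → E.card = k) :
    ∑ T, weightDegree ν T = 2 ^ k * ∑ E, ν E := by
  unfold weightDegree
  simp_rw [Finset.sum_filter]
  rw [Finset.sum_comm, Finset.mul_sum]
  refine Finset.sum_congr rfl fun E _ => ?_
  rw [← Finset.sum_filter, Finset.sum_const, nsmul_eq_mul]
  by_cases h : ν E = 0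
  · simp [h]
  · have : (Finset.univ.filter fun T => T ⊆ E) = E.powerset := by ext; simp
    rw [this, Finset.card_powerset, hν E h]
    push_cast
    rfl

theorem IsSpread.add {K τ N : ℝ} {k : ℕ} {μ ν : Finset α → ℝ} (hμ : ∀ E, 0 ≤ μ E)
    (hν : ∀ E, 0 ≤ ν E) (hμk : ∀ E, μ E ≠ 0 → E.card = k) (hνk : ∀ E, ν E ≠ 0 → E.card = k)
    (h : ∀ T : Finset α, T.Nonempty →
      weightDegree μ T + weightDegree ν T ≤ K * τ ^ (T.card - 1) / N) :
    IsSpread K τ N k (μ + ν) where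
  nonneg E := add_nonneg (hμ E) (hν E)
  card_eq E hE := by
    by_cases h0 : μ E = 0
    · exact hνk E fun h1 => hE (by simp [h0, h1])
    · exact hμk E h0
  degree_le T hT := by
    have : weightDegree (μ + ν) T = weightDegree μ T + weightDegree ν T := by
      simp [weightDegree, Finset.sum_add_distrib]
    rw [this]
    exact h T hT

/-- A weight on the links of `F` that cannot be increased much by adding any vertex of `C` to `F`
forces the edges inside `C` to be light. -/
theorem IsSpread.sum_subset_le {K τ N a : ℝ} {k : ℕ} {μ ν : Finset α → ℝ} {F C : Finset α}
    (hμ : IsSpread K τ N (k + 1) μ) (hK : 0 ≤ K) (hτ : 0 < τ) (hN : 0 < N) (ha : 0 ≤ a)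
    (hcard : (Fintype.card α : ℝ) ≤ N)
    (hν : ν ∈ linkWeights (2 * K) τ N k μ F)
    (hC : ∀ v ∈ C, ∀ ν' ∈ linkWeights (2 * K) τ N k μ (insert v F),
      ∑ E, ν' E ≤ ∑ E, ν E + a / (τ * N)) :
    ∑ E with E ⊆ C, μ E ≤ a + 2 ^ k * ∑ E, ν E := by
  classical
  set sat : Finset (Finset α) :=
    Finset.univ.filter fun T => T.Nonempty ∧ K * τ ^ (T.card - 1) / N < weightDegree ν T with hsat
  have hmem : ∀ T, T ∈ sat ↔ T.Nonempty ∧ K * τ ^ (T.card - 1) / N < weightDegree ν T := by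
    intro T; simp [hsat]
  have key : ∀ v ∈ C, ∑ E with v ∈ E ∧ ∀ T ∈ sat, ¬ T ⊆ E, μ E ≤ a / N := by
    intro v hv
    set μv : Finset α → ℝ := fun E =>
      if v ∉ E ∧ ∀ T ∈ sat, ¬ T ⊆ E then μ (insert v E) / τ else 0 with hμv
    have hμv0 : ∀ E, 0 ≤ μv E := by
      intro E
      simp only [hμv]
      split_ifs
      · exact div_nonneg (hμ.nonneg _) hτ.le
      · exact le_rfl
    have hne : ∀ E, μv E ≠ 0 → v ∉ E ∧ (∀ T ∈ sat, ¬ T ⊆ E) ∧ μ (insert v E) ≠ 0 := by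
      intro E hE
      simp only [hμv] at hE
      split_ifs at hE with h
      · refine ⟨h.1, h.2, fun h0 => hE (by simp [h0])⟩
      · exact absurd rfl hE
    have hdeg : ∀ T : Finset α, T.Nonempty → T ∉ sat →
        weightDegree μv T ≤ K * τ ^ (T.card - 1) / N := by
      intro T hT _
      by_cases hvT : v ∈ T
      · have : weightDegree μv T = 0 := by
          refine Finset.sum_eq_zero fun E hE => ?_
          by_contra h0
          exact (hne E h0).1 ((Finset.mem_filter.1 hE).2 hvT)
        rw [this]
        positivity
      · calc weightDegree μv T ≤ ∑ E with T ⊆ E ∧ v ∉ E, μ (insert v E) / τ := by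
              rw [weightDegree, Finset.sum_filter, Finset.sum_filter]
              refine Finset.sum_le_sum fun E _ => ?_
              have := div_nonneg (hμ.nonneg (insert v E)) hτ.le
              simp only [hμv]
              split_ifs <;> tauto
          _ = (∑ E ∈ (Finset.univ.filter fun E => T ⊆ E ∧ v ∉ E).image (insert v), μ E) / τ := by
              rw [Finset.sum_image, Finset.sum_div]
              intro E hE E' hE' h
              have h1 : v ∉ E := by simpa using (Finset.mem_filter.1 hE).2.2
              have h2 : v ∉ E' := by simpa using (Finset.mem_filter.1 hE').2.2
              rw [← Finset.erase_insert h1, ← Finset.erase_insert h2]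
              rw [h]
          _ ≤ weightDegree μ (insert v T) / τ := by
              gcongr
              refine Finset.sum_le_sum_of_subset_of_nonneg ?_ fun E _ _ => hμ.nonneg E
              intro E hE
              obtain ⟨E', hE', rfl⟩ := Finset.mem_image.1 hE
              simp only [Finset.mem_filter, Finset.mem_univ, true_and] at hE' ⊢
              exact Finset.insert_subset_insert _ hE'.1
          _ ≤ (K * τ ^ T.card / N) / τ := by
              gcongr
              have := hμ.degree_le (insert v T) (by simp)
              rwa [Finset.card_insert_of_notMem hvT, Nat.add_sub_cancel] at this
          _ = K * τ ^ (T.card - 1) / N := by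
              obtain ⟨j, hj⟩ : ∃ j, T.card = j + 1 := ⟨T.card - 1, by
                have := hT.card_pos; omega⟩
              rw [hj, Nat.add_sub_cancel, pow_succ]
              field_simp
    have hmemv : ν + μv ∈ linkWeights (2 * K) τ N k μ (insert v F) := by
      constructor
      · apply IsSpread.add hν.1.nonneg hμv0 hν.1.card_eq
        · intro E hE
          obtain ⟨h1, _, h2⟩ := hne E hE
          have := hμ.card_eq _ h2
          rw [Finset.card_insert_of_notMem h1] at this
          omega
        · intro T hT
          by_cases hTs : T ∈ sat
          · have : weightDegree μv T = 0 := by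
              refine Finset.sum_eq_zero fun E hE => ?_
              by_contra h0
              exact (hne E h0).2.1 T hTs (Finset.mem_filter.1 hE).2
            rw [this, add_zero]
            exact hν.1.degree_le T hT
          · have h1 := hdeg T hT hTs
            have h2 : weightDegree ν T ≤ K * τ ^ (T.card - 1) / N := by
              by_contra h
              exact hTs ((hmem T).2 ⟨hT, not_le.1 h⟩)
            calc _ ≤ K * τ ^ (T.card - 1) / N + K * τ ^ (T.card - 1) / N := add_le_add h2 h1
              _ = _ := by ring
      · intro E hE
        by_cases h0 : ν E = 0
        · have : μv E ≠ 0 := fun h1 => hE (by simp [h0, h1])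
          obtain ⟨h1, _, h2⟩ := hne E this
          exact ⟨v, by simp, h1, h2⟩
        · obtain ⟨w, hw, h⟩ := hν.2 E h0
          exact ⟨w, Finset.mem_insert_of_mem hw, h⟩
    have h1 := hC v hv _ hmemv
    simp only [Pi.add_apply, Finset.sum_add_distrib] at h1
    have h2 : ∑ E with v ∈ E ∧ ∀ T ∈ sat, ¬ T ⊆ E, μ E ≤ τ * ∑ E, μv E := by
      calc _ ≤ ∑ E with v ∈ E ∧ ∀ T ∈ sat, ¬ T ⊆ E, τ * μv (E.erase v) := by
            refine Finset.sum_le_sum fun E hE => ?_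
            simp only [Finset.mem_filter, Finset.mem_univ, true_and] at hE
            have : v ∉ E.erase v ∧ ∀ T ∈ sat, ¬ T ⊆ E.erase v :=
              ⟨by simp, fun T hT h => hE.2 T hT (h.trans (Finset.erase_subset _ _))⟩
            simp only [hμv, if_pos this, Finset.insert_erase hE.1]
            apply le_of_eq
            field_simp
        _ = τ * ∑ E ∈ (Finset.univ.filter fun E => v ∈ E ∧ ∀ T ∈ sat, ¬ T ⊆ E).image
              (fun E => E.erase v), μv E := by
            rw [Finset.sum_image, Finset.mul_sum]
            intro E hE E' hE' h
            have h1 : v ∈ E := by simpa using (Finset.mem_filter.1 hE).2.1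
            have h2 : v ∈ E' := by simpa using (Finset.mem_filter.1 hE').2.1
            rw [← Finset.insert_erase h1, ← Finset.insert_erase h2]
            exact congrArg (insert v) h
        _ ≤ _ := by
            gcongr
            · exact fun _ _ _ => hμv0 _
            · exact Finset.subset_univ _
    calc _ ≤ _ := h2
      _ ≤ τ * (a / (τ * N)) := by
          gcongr
          linarith
      _ = a / N := by field_simp
  have hfree : ∑ E with E ⊆ C ∧ ∀ T ∈ sat, ¬ T ⊆ E, μ E ≤ a := by
    calc _ ≤ ∑ v ∈ C, ∑ E with v ∈ E ∧ ∀ T ∈ sat, ¬ T ⊆ E, μ E := by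
          simp_rw [Finset.sum_filter]
          rw [Finset.sum_comm]
          refine Finset.sum_le_sum fun E _ => ?_
          have hnn : ∀ v ∈ C, 0 ≤ if v ∈ E ∧ ∀ T ∈ sat, ¬ T ⊆ E then μ E else 0 := by
            intro v _
            split_ifs
            · exact hμ.nonneg E
            · exact le_rfl
          split_ifs with h
          · by_cases h0 : μ E = 0
            · rw [h0] at hnn ⊢
              exact Finset.sum_nonneg hnn
            · have := hμ.card_eq E h0
              obtain ⟨v, hv⟩ := Finset.card_pos.1 (by omega : 0 < E.card)
              refine le_trans ?_ (Finset.single_le_sum hnn (h.1 hv))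
              rw [if_pos ⟨hv, h.2⟩]
          · exact Finset.sum_nonneg hnn
      _ ≤ ∑ v ∈ C, a / N := Finset.sum_le_sum key
      _ = C.card * (a / N) := by simp
      _ ≤ N * (a / N) := by
          gcongr
          exact le_trans (by exact_mod_cast Finset.card_le_univ C) hcard
      _ = a := by field_simp
  have hrest : ∑ E with ¬ (∀ T ∈ sat, ¬ T ⊆ E), μ E ≤ 2 ^ k * ∑ E, ν E := by
    calc _ ≤ ∑ T ∈ sat, weightDegree μ T := by
          apply sum_le_sum_weightDegree hμ.nonneg
          intro E hE _
          simpa using (Finset.mem_filter.1 hE).2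
      _ ≤ ∑ T ∈ sat, weightDegree ν T := by
          refine Finset.sum_le_sum fun T hT => ?_
          have := (hmem T).1 hT
          exact (hμ.degree_le T this.1).trans this.2.le
      _ ≤ ∑ T, weightDegree ν T := Finset.sum_le_sum_of_subset_of_nonneg (Finset.subset_univ _)
          fun T _ _ => weightDegree_nonneg hν.1.nonneg T
      _ = _ := sum_weightDegree hν.1.card_eq
  calc ∑ E with E ⊆ C, μ E ≤ ∑ E with E ⊆ C ∧ ∀ T ∈ sat, ¬ T ⊆ E, μ E +
        ∑ E with ¬ (∀ T ∈ sat, ¬ T ⊆ E), μ E := by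
        simp_rw [Finset.sum_filter]
        rw [← Finset.sum_add_distrib]
        refine Finset.sum_le_sum fun E _ => ?_
        have := hμ.nonneg E
        split_ifs <;> first | tauto | linarith
    _ ≤ _ := add_le_add hfree hrest

end Level

theorem IsSpread.smul {α : Type*} [Fintype α] [DecidableEq α] {K τ N b : ℝ} {k : ℕ}
    {μ : Finset α → ℝ} (h : IsSpread K τ N k μ) (hb : 0 ≤ b) : IsSpread (b * K) τ N k (b • μ) where
  nonneg E := mul_nonneg hb (h.nonneg E)
  card_eq E hE := h.card_eq E fun h0 => hE (by simp [h0])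
  degree_le T hT := by
    have : weightDegree (b • μ) T = b * weightDegree μ T := by
      simp [weightDegree, Finset.mul_sum]
    rw [this, show b * K * τ ^ (T.card - 1) / N = b * (K * τ ^ (T.card - 1) / N) by ring]
    exact mul_le_mul_of_nonneg_left (h.degree_le T hT) hb

/-- The vertices contained in an edge of positive weight. -/
noncomputable def weightSupport {α : Type*} [Fintype α] (μ : Finset α → ℝ) : Finset α :=
  open Classical in Finset.univ.filter fun v => ∃ E, v ∈ E ∧ μ E ≠ 0

theorem mem_weightSupport {α : Type*} [Fintype α] {μ : Finset α → ℝ} {v : α} :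
    v ∈ weightSupport μ ↔ ∃ E, v ∈ E ∧ μ E ≠ 0 := by
  simp [weightSupport]

theorem exists_containerCover_of_isSpread (k : ℕ) : ∀ K : ℝ, 0 < K → ∃ (L : ℕ) (c : ℝ), 0 < c ∧
    ∀ (α : Type) [Fintype α] [DecidableEq α] (N τ : ℝ) (μ : Finset α → ℝ), 0 < τ → 0 < N →
      (Fintype.card α : ℝ) ≤ N → IsSpread K τ N (k + 1) μ → 1 ≤ ∑ E, μ E →
      ContainerCover L (τ * N) (fun I => ∀ E ⊆ I, μ E = 0)
        (fun C => c * N ≤ ((weightSupport μ \ C).card : ℝ)) := by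
  induction k with
  | zero =>
    intro K hK
    refine ⟨0, 1 / K, by positivity, ?_⟩
    intro α _ _ N τ μ hτ hN hcard hμ hmass
    apply containerCover_singleton (by positivity) (Finset.univ \ weightSupport μ)
    · intro I hI v hv
      simp only [Finset.mem_sdiff, Finset.mem_univ, true_and, mem_weightSupport]
      rintro ⟨E, hvE, hE⟩
      obtain ⟨w, rfl⟩ := Finset.card_eq_one.1 (hμ.card_eq E hE)
      rw [Finset.mem_singleton] at hvE
      subst hvE
      exact hE (hI _ (by simpa using hv))
    · have h1 : weightSupport μ \ (Finset.univ \ weightSupport μ) = weightSupport μ := by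
        ext; simp
      rw [h1]
      have h2 := hμ.sum_meeting_le (weightSupport μ) Finset.univ (by
        intro E _ hE
        have := hμ.card_eq E hE
        obtain ⟨v, hv⟩ := Finset.card_pos.1 (by omega : 0 < E.card)
        exact ⟨v, mem_weightSupport.2 ⟨E, hv, hE⟩, hv⟩)
      have h3 := hmass.trans h2
      rw [mul_div_assoc', le_div_iff₀ hN] at h3
      rw [div_mul_eq_mul_div, div_le_iff₀ hK]
      linarith
  | succ k ih =>
    intro K hK
    set β : ℝ := 1 / (4 * 2 ^ (k + 1)) with hβ
    have hβ0 : 0 < β := by positivity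
    obtain ⟨L', c', hc', ih⟩ := ih (β⁻¹ * (2 * K)) (by positivity)
    set L₁ : ℕ := ⌈8 * K⌉₊ + 1 with hL₁
    refine ⟨L₁ + L', min c' (1 / (2 * K)), by positivity, ?_⟩
    intro α _ _ N τ μ hτ hN hcard hμ hmass
    choose ν hν hmax using
      exists_isMaxOn_linkWeights (by positivity : 0 ≤ 2 * K) hτ.le hN hcard k μ
    have hmass0 : ∀ F, 0 ≤ ∑ E, ν F E := fun F => Finset.sum_nonneg fun E _ => (hν F).1.nonneg E
    have hmassK : ∀ F, ∑ E, ν F E ≤ 2 * K := fun F => (hν F).1.sum_le (by positivity) hN hcard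
    set a : ℝ := 1 / 4 with ha
    set D : Finset α → Finset α := fun F =>
      Finset.univ.filter fun v => ∑ E, ν (insert v F) E ≤ ∑ E, ν F E + a / (τ * N) with hD
    apply ContainerCover.bind
      ((Finset.univ.filter fun F : Finset α => (F.card : ℝ) ≤ L₁ * (τ * N)).image
        fun F => (F, (∅ : Finset α)))
      (fun x J => (β ≤ ∑ E, ν x.1 E → ∀ E ⊆ J, ν x.1 E = 0) ∧
        (¬ β ≤ ∑ E, ν x.1 E → J ⊆ D x.1))
    · intro I hI
      obtain ⟨F, hF, hFmax⟩ := Finset.exists_max_image I.powerset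
        (fun F => ∑ E, ν F E - F.card * (a / (τ * N))) ⟨∅, by simp⟩
      rw [Finset.mem_powerset] at hF
      have hFcard : (F.card : ℝ) ≤ L₁ * (τ * N) := by
        have h0 := hFmax ∅ (by simp)
        simp only [Finset.card_empty, Nat.cast_zero, zero_mul, sub_zero] at h0
        have h1 : F.card * (a / (τ * N)) ≤ 2 * K := by linarith [hmassK F, hmass0 ∅]
        rw [mul_div_assoc', div_le_iff₀ (by positivity)] at h1
        have h2 : 8 * K ≤ L₁ := by
          rw [hL₁]; push_cast; linarith [Nat.le_ceil (8 * K)]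
        have h3 : 8 * K * (τ * N) ≤ L₁ * (τ * N) := by gcongr
        rw [ha] at h1
        linarith
      refine ⟨(F, ∅), Finset.mem_image_of_mem _ (by simpa using hFcard), hF, ?_, ?_⟩
      · intro _ E hE
        by_contra h0
        obtain ⟨v, hv, hvE, h⟩ := (hν F).2 E h0
        exact h (hI _ (Finset.insert_subset (hF hv) (hE.trans Finset.sdiff_subset)))
      · intro _ v hv
        simp only [Finset.mem_sdiff] at hv
        simp only [hD, Finset.mem_filter, Finset.mem_univ, true_and]
        have := hFmax (insert v F) (Finset.mem_powerset.2 (Finset.insert_subset hv.1 hF))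
        simp only [Finset.card_insert_of_notMem hv.2] at this
        push_cast at this
        linarith
    · intro x hx
      simp only [Finset.mem_image, Finset.mem_filter, Finset.mem_univ, true_and] at hx
      obtain ⟨F, hF, rfl⟩ := hx
      exact hF
    · intro y hy
      calc _ ≤ ∑ F ∈ (Finset.univ.filter fun F : Finset α => (F.card : ℝ) ≤ L₁ * (τ * N)),
            y ^ F.card := sum_image_le_sum _ _ (fun x : Finset α × Finset α => y ^ x.1.card)
              (fun _ => by positivity)
        _ ≤ ∑ F : Finset α, y ^ F.card := Finset.sum_le_sum_of_subset_of_nonneg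
            (Finset.subset_univ _) (by intros; positivity)
        _ = (1 + y) ^ Fintype.card α := by
            have := Finset.sum_pow_mul_eq_add_pow y 1 (Finset.univ : Finset α)
            simpa [add_comm] using this
        _ ≤ (1 + y) ^ (L₁ * Fintype.card α) := by
            apply pow_le_pow_right₀ (by linarith)
            exact Nat.le_mul_of_pos_left _ (by omega)
    · intro x _
      obtain ⟨F, G⟩ := x
      by_cases hF : β ≤ ∑ E, ν F E
      · have hsp := (hν F).1.smul (b := β⁻¹) (by positivity)
        have hm : 1 ≤ ∑ E, (β⁻¹ • ν F) E := by
          simp only [Pi.smul_apply, smul_eq_mul, ← Finset.mul_sum]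
          rw [inv_mul_eq_div, one_le_div hβ0]
          exact hF
        refine (ih α N τ _ hτ hN hcard hsp hm).mono (by positivity) le_rfl ?_ ?_
        · intro I hI E hE
          simp [hI.1 hF E hE]
        · intro C hC
          calc min c' (1 / (2 * K)) * N ≤ c' * N := by gcongr; exact min_le_left _ _
            _ ≤ _ := hC
            _ ≤ _ := by
              gcongr
              intro v hv
              obtain ⟨E, hvE, hE⟩ := mem_weightSupport.1 hv
              have h0 : ν F E ≠ 0 := fun h => hE (by simp [h])
              obtain ⟨w, _, _, h⟩ := (hν F).2 E h0
              exact mem_weightSupport.2 ⟨_, Finset.mem_insert_of_mem hvE, h⟩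
      · apply containerCover_singleton (by positivity) (D F) (fun I hI => hI.2 hF)
        have h1 := hμ.sum_subset_le (C := D F) (a := a) hK.le hτ hN (by positivity) hcard (hν F) (by
          intro v hv ν' hν'
          refine (hmax _ ν' hν').trans ?_
          simpa [hD] using hv)
        have h2 : 2 ^ (k + 1) * ∑ E, ν F E ≤ 1 / 4 := by
          calc _ ≤ 2 ^ (k + 1) * β := by gcongr; exact (not_le.1 hF).le
            _ = 1 / 4 := by rw [hβ]; field_simp
        have h3 := hμ.sum_meeting_le (weightSupport μ \ D F)
          (Finset.univ.filter fun E => ¬ E ⊆ D F) (by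
            intro E hE h0
            obtain ⟨v, hv, hvD⟩ := Finset.not_subset.1 (Finset.mem_filter.1 hE).2
            exact ⟨v, by simp [hvD, mem_weightSupport]; exact ⟨E, hv, h0⟩, hv⟩)
        have h4 : ∑ E with E ⊆ D F, μ E + ∑ E with ¬ E ⊆ D F, μ E = ∑ E, μ E :=
          Finset.sum_filter_add_sum_filter_not Finset.univ (fun E => E ⊆ D F) μ
        have h1' : ∑ E with E ⊆ D F, μ E ≤ 1 / 4 + 1 / 4 := h1.trans (add_le_add le_rfl h2)
        have h5 : 1 / 2 ≤ ((weightSupport μ \ D F).card : ℝ) * (K / N) := by linarith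
        calc min c' (1 / (2 * K)) * N ≤ 1 / (2 * K) * N := by gcongr; exact min_le_right _ _
          _ ≤ _ := by
            rw [mul_div_assoc', le_div_iff₀ hN] at h5
            rw [div_mul_eq_mul_div, div_le_iff₀ (by positivity)]
            linarith

/-- The container theorem: a family of forbidden sets such that every set that is not `good`
carries a well spread weight on the forbidden sets has a good container cover. -/
theorem exists_containerCover (k : ℕ) (K : ℝ) (hK : 0 < K) : ∃ L : ℕ,
    ∀ (α : Type) [Fintype α] [DecidableEq α] (N τ : ℝ) (P good : Finset α → Prop), 0 < τ → 0 < N →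
      (Fintype.card α : ℝ) ≤ N → (∀ I J, J ⊆ I → P I → P J) →
      (∀ C, ¬ good C → ∃ μ : Finset α → ℝ, IsSpread K τ N (k + 1) μ ∧ 1 ≤ ∑ E, μ E ∧
        ∀ E, μ E ≠ 0 → E ⊆ C ∧ ∀ I, P I → ¬ E ⊆ I) →
      ContainerCover L (τ * N) P good := by
  obtain ⟨L, c, hc, h⟩ := exists_containerCover_of_isSpread k K hK
  have key : ∀ m : ℕ, ∃ L' : ℕ,
    ∀ (α : Type) [Fintype α] [DecidableEq α] (N τ : ℝ) (P good : Finset α → Prop), 0 < τ → 0 < N →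
      (Fintype.card α : ℝ) ≤ N → (∀ I J, J ⊆ I → P I → P J) →
      (∀ C, ¬ good C → ∃ μ : Finset α → ℝ, IsSpread K τ N (k + 1) μ ∧ 1 ≤ ∑ E, μ E ∧
        ∀ E, μ E ≠ 0 → E ⊆ C ∧ ∀ I, P I → ¬ E ⊆ I) →
      ContainerCover L' (τ * N) P (fun C => good C ∨ (C.card : ℝ) ≤ N - m * (c * N)) := by
    intro m
    induction m with
    | zero =>
      refine ⟨0, fun α _ _ N τ P good hτ hN hcard hP hμ => ?_⟩
      apply containerCover_singleton (by positivity) Finset.univ (fun I _ => Finset.subset_univ _)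
      right
      simpa using hcard
    | succ m ih =>
      obtain ⟨L', ih⟩ := ih
      refine ⟨L' + L, fun α _ _ N τ P good hτ hN hcard hP hμ => ?_⟩
      obtain ⟨𝒞, h1, h2, h3⟩ := ih α N τ P good hτ hN hcard hP hμ
      apply ContainerCover.bind 𝒞 (fun x J => P J ∧ J ⊆ x.2) _ (fun x hx => (h2 x hx).1) h3
      · intro x hx
        by_cases hg : good x.2
        · exact containerCover_singleton (by positivity) x.2 (fun I hI => hI.2) (Or.inl hg)
        have hcx := (h2 x hx).2.resolve_left hg
        obtain ⟨μ, hsp, hmass, hE⟩ := hμ x.2 hg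
        obtain ⟨𝒟, g1, g2, g3⟩ := h α N τ μ hτ hN hcard hsp hmass
        refine ⟨𝒟.image fun z => (z.1, x.2 ∩ z.2), ?_, ?_, ?_⟩
        · rintro I ⟨hI, hIx⟩
          obtain ⟨z, hz, hz1, hz2⟩ := g1 I (fun E hEI => by
            by_contra h0
            exact (hE E h0).2 I hI hEI)
          refine ⟨_, Finset.mem_image_of_mem _ hz, hz1, ?_⟩
          exact Finset.subset_inter (Finset.sdiff_subset.trans hIx) hz2
        · intro w hw
          obtain ⟨z, hz, rfl⟩ := Finset.mem_image.1 hw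
          refine ⟨(g2 z hz).1, Or.inr ?_⟩
          have hz2 := (g2 z hz).2
          have hle : (weightSupport μ \ z.2).card + (x.2 ∩ z.2).card ≤ x.2.card := by
            rw [← Finset.card_union_of_disjoint]
            · apply Finset.card_le_card
              apply Finset.union_subset _ Finset.inter_subset_left
              intro v hv
              obtain ⟨E, hvE, h0⟩ := mem_weightSupport.1 (Finset.mem_sdiff.1 hv).1
              exact (hE E h0).1 hvE
            · rw [Finset.disjoint_left]
              intro v hv hv'
              exact (Finset.mem_sdiff.1 hv).2 (Finset.mem_inter.1 hv').2
          have hle' : ((weightSupport μ \ z.2).card : ℝ) + ((x.2 ∩ z.2).card : ℝ) ≤ x.2.card := by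
            exact_mod_cast hle
          push_cast
          linarith
        · intro y hy
          exact (sum_image_le_sum _ _ (fun x : Finset α × Finset α => y ^ x.1.card)
              (fun _ => by positivity)).trans (g3 y hy)
      · intro I hI
        obtain ⟨x, hx, hx1, hx2⟩ := h1 I hI
        exact ⟨x, hx, hx1, hP _ _ Finset.sdiff_subset hI, hx2⟩
  obtain ⟨m, hm⟩ := exists_nat_gt (1 / c)
  obtain ⟨L', key⟩ := key m
  refine ⟨L', fun α _ _ N τ P good hτ hN hcard hP hμ => ?_⟩
  refine (key α N τ P good hτ hN hcard hP hμ).mono (by positivity) le_rfl (fun _ h => h) ?_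
  rintro C (hC | hC)
  · exact hC
  · exfalso
    rw [div_lt_iff₀ hc] at hm
    have : (0 : ℝ) ≤ C.card := by positivity
    nlinarith

/-- The number of `d`-tuples of pairwise adjacent vertices of `W`. -/
def cliqueTuples {X : Type*} (G : SimpleGraph X) [DecidableRel G.Adj] :
    ℕ → Finset X → ℕ
  | 0, _ => 1
  | d + 1, W => ∑ x ∈ W, cliqueTuples G d (W.filter (G.Adj x))

/-- The number of adjacent ordered pairs in `A × B`. -/
def adjPairs {X : Type*} (G : SimpleGraph X) [DecidableRel G.Adj] (A B : Finset X) : ℝ :=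
  ∑ x ∈ A, ∑ y ∈ B, if G.Adj x y then 1 else 0

/-- The number of adjacent ordered pairs in `W × W` that are monochromatic. -/
def monoPairs {X κ : Type*} [DecidableEq κ] (G : SimpleGraph X) [DecidableRel G.Adj] (c : X → κ)
    (W : Finset X) : ℝ :=
  ∑ x ∈ W, ∑ y ∈ W, if G.Adj x y ∧ c x = c y then 1 else 0

section

variable {X : Type*} (G : SimpleGraph X) [DecidableRel G.Adj]

theorem adjPairs_comm (A B : Finset X) : adjPairs G A B = adjPairs G B A := by
  unfold adjPairs
  rw [Finset.sum_comm]
  simp_rw [G.adj_comm]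

theorem adjPairs_eq (A B : Finset X) :
    adjPairs G A B = ∑ x ∈ A, ((B.filter (G.Adj x)).card : ℝ) := by
  simp [adjPairs]

theorem monoPairs_le {κ : Type*} [DecidableEq κ] (c : X → κ) (W : Finset X) :
    monoPairs G c W ≤ adjPairs G W W := by
  refine Finset.sum_le_sum fun x _ => Finset.sum_le_sum fun y _ => ?_
  split_ifs <;> first | tauto | norm_num

theorem adjPairs_le (A B : Finset X) : adjPairs G A B ≤ A.card * B.card := by
  rw [adjPairs_eq]
  calc _ ≤ ∑ x ∈ A, (B.card : ℝ) := by
        gcongr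
        exact Finset.filter_subset _ _
    _ = _ := by simp

theorem adjPairs_split_left (q : X → Prop) [DecidablePred q] (W B : Finset X) :
    adjPairs G W B = adjPairs G (W.filter q) B + adjPairs G (W.filter fun x => ¬ q x) B :=
  (Finset.sum_filter_add_sum_filter_not W q _).symm

theorem adjPairs_split_right (q : X → Prop) [DecidablePred q] (W B : Finset X) :
    adjPairs G B W = adjPairs G B (W.filter q) + adjPairs G B (W.filter fun x => ¬ q x) := by
  rw [adjPairs_comm, adjPairs_split_left G q, adjPairs_comm, adjPairs_comm G _ B]

theorem monoPairs_extend_le {r : ℕ} (c : X → Fin r) (q : X → Prop) [DecidablePred q]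
    (W : Finset X) :
    monoPairs G (fun x => if q x then (c x).castSucc else Fin.last r) W ≤
      monoPairs G c (W.filter q) +
        adjPairs G (W.filter fun x => ¬ q x) (W.filter fun x => ¬ q x) := by
  unfold monoPairs adjPairs
  rw [← Finset.sum_filter_add_sum_filter_not W q]
  gcongr with x hx x hx
  · have hx := (Finset.mem_filter.1 hx).2
    rw [← Finset.sum_filter_add_sum_filter_not W q]
    refine (add_le_add (Finset.sum_le_sum fun y hy => ?_)
      (Finset.sum_nonpos fun y hy => ?_)).trans_eq (add_zero _)
    · have hy := (Finset.mem_filter.1 hy).2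
      simp [hx, hy]
    · have hy := (Finset.mem_filter.1 hy).2
      simp [hx, hy, (Fin.castSucc_lt_last _).ne]
  · have hx := (Finset.mem_filter.1 hx).2
    rw [← Finset.sum_filter_add_sum_filter_not W q]
    refine (add_le_add (Finset.sum_nonpos fun y hy => ?_)
      (Finset.sum_le_sum fun y hy => ?_)).trans_eq (zero_add _)
    · have hy := (Finset.mem_filter.1 hy).2
      simp [hx, hy, (Fin.castSucc_lt_last _).ne']
    · have hy := (Finset.mem_filter.1 hy).2
      simp [hx, hy]

end

/-- A graph with few cliques on `r + 2` vertices has an `(r + 1)`-colouring such that the number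
of edges plus the number of monochromatic edges is essentially bounded by the Turán number. -/
theorem exists_coloring_of_cliqueTuples_le (r : ℕ) : ∀ η : ℝ, 0 < η → ∃ δ : ℝ, 0 < δ ∧
    ∀ (X : Type) [Fintype X] (G : SimpleGraph X) [DecidableRel G.Adj] (W : Finset X),
      (cliqueTuples G (r + 2) W : ℝ) ≤ δ * (Fintype.card X : ℝ) ^ (r + 2) →
      ∃ c : X → Fin (r + 1), adjPairs G W W + monoPairs G c W ≤
        (1 - 1 / ((r : ℝ) + 1)) * (W.card : ℝ) ^ 2 + η * (Fintype.card X : ℝ) ^ 2 := by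
  induction r with
  | zero =>
    intro η hη
    refine ⟨η / 2, by positivity, fun X _ G _ W h => ⟨fun _ => 0, ?_⟩⟩
    have h1 : (cliqueTuples G (0 + 2) W : ℝ) = adjPairs G W W := by
      rw [adjPairs_eq]; simp [cliqueTuples]
    have h2 := monoPairs_le G (fun _ => (0 : Fin (0 + 1))) W
    rw [h1] at h
    norm_num at h ⊢
    linarith
  | succ r ih =>
    intro η hη
    obtain ⟨δ, hδ, ih⟩ := ih (η / 3) (by positivity)
    refine ⟨δ * (η / 6), by positivity, fun X _ G _ W h => ?_⟩
    set n : ℝ := (Fintype.card X : ℝ) with hn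
    rcases (Nat.cast_nonneg (Fintype.card X) : (0 : ℝ) ≤ n).eq_or_lt with hn0 | hn0
    · refine ⟨fun _ => 0, ?_⟩
      have hX : Fintype.card X = 0 := by
        exact_mod_cast hn0.symm
      have : IsEmpty X := Fintype.card_eq_zero_iff.1 hX
      rw [Finset.eq_empty_of_isEmpty W]
      simp [adjPairs, monoPairs]
      positivity
    have hWn : (W.card : ℝ) ≤ n := by
      rw [hn]; exact_mod_cast Finset.card_le_univ W
    set good : X → Prop := fun x =>
      (cliqueTuples G (r + 2) (W.filter (G.Adj x)) : ℝ) ≤ δ * n ^ (r + 2) with hgood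
    classical
    have hbad : ((W.filter fun x => ¬ good x).card : ℝ) ≤ η / 6 * n := by
      have h1 : ((W.filter fun x => ¬ good x).card : ℝ) * (δ * n ^ (r + 2)) ≤
          cliqueTuples G (r + 3) W := by
        rw [cliqueTuples]
        push_cast
        calc _ = ∑ x ∈ W.filter (fun x => ¬ good x), δ * n ^ (r + 2) := by simp
          _ ≤ ∑ x ∈ W.filter (fun x => ¬ good x),
              (cliqueTuples G (r + 2) (W.filter (G.Adj x)) : ℝ) := by
            refine Finset.sum_le_sum fun x hx => ?_
            exact (not_le.1 (Finset.mem_filter.1 hx).2).le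
          _ ≤ _ := Finset.sum_le_sum_of_subset_of_nonneg (Finset.filter_subset _ _)
            (by intros; positivity)
      have h2 := h1.trans h
      rw [show δ * (η / 6) * n ^ (r + 1 + 2) = η / 6 * n * (δ * n ^ (r + 2)) by ring] at h2
      exact le_of_mul_le_mul_right h2 (by positivity)
    have hr : (0 : ℝ) ≤ 1 - 1 / (((r + 1 : ℕ) : ℝ) + 1) := by
      rw [sub_nonneg, div_le_one (by positivity)]
      push_cast
      linarith [(Nat.cast_nonneg r : (0 : ℝ) ≤ r)]
    by_cases hne : (W.filter good).Nonempty
    · obtain ⟨x₀, hx₀, hmax⟩ := Finset.exists_max_image (W.filter good)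
        (fun x => (W.filter (G.Adj x)).card) hne
      obtain ⟨c, hc⟩ := ih X G (W.filter (G.Adj x₀)) (Finset.mem_filter.1 hx₀).2
      refine ⟨fun x => if G.Adj x₀ x then (c x).castSucc else Fin.last _, ?_⟩
      set A := W.filter (G.Adj x₀) with hA
      set B := W.filter (fun x => ¬ G.Adj x₀ x) with hB
      have hcard : (W.card : ℝ) = A.card + B.card := by
        exact_mod_cast (Finset.card_filter_add_card_filter_not (G.Adj x₀)).symm
      have h1 := monoPairs_extend_le G c (G.Adj x₀) W
      have h2 : adjPairs G W W = adjPairs G A A + adjPairs G A B + adjPairs G B W := by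
        rw [adjPairs_split_left G (G.Adj x₀) W W, adjPairs_split_right G (G.Adj x₀) W A]
      have h3 : adjPairs G B W = adjPairs G A B + adjPairs G B B := by
        rw [adjPairs_split_right G (G.Adj x₀) W B, adjPairs_comm G A B]
      have h4 : adjPairs G B W ≤ A.card * B.card + η / 6 * n * n := by
        rw [adjPairs_eq]
        calc _ ≤ ∑ x ∈ B, ((A.card : ℝ) + if ¬ good x then n else 0) := by
              refine Finset.sum_le_sum fun x hx => ?_
              have hxW := (Finset.mem_filter.1 hx).1
              by_cases hg : good x
              · simp only [hg, not_true_eq_false, if_false, add_zero]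
                exact_mod_cast hmax x (Finset.mem_filter.2 ⟨hxW, hg⟩)
              · simp only [hg, not_false_eq_true, if_true]
                have : ((W.filter (G.Adj x)).card : ℝ) ≤ n := by
                  rw [hn]; exact_mod_cast Finset.card_le_univ _
                have : (0 : ℝ) ≤ A.card := by positivity
                linarith
          _ ≤ A.card * B.card + ((W.filter fun x => ¬ good x).card : ℝ) * n := by
              rw [Finset.sum_add_distrib, ← Finset.sum_filter]
              simp only [Finset.sum_const, nsmul_eq_mul]
              rw [mul_comm (B.card : ℝ)]
              gcongr
              exact Finset.filter_subset _ _
          _ ≤ _ := by gcongr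
      have h5 : (1 - 1 / ((r : ℝ) + 1)) * (A.card : ℝ) ^ 2 + 2 * (A.card * B.card) ≤
          (1 - 1 / (((r + 1 : ℕ) : ℝ) + 1)) * (A.card + B.card : ℝ) ^ 2 := by
        rw [← sub_nonneg]
        have : (1 - 1 / (((r + 1 : ℕ) : ℝ) + 1)) * (A.card + B.card : ℝ) ^ 2 -
            ((1 - 1 / ((r : ℝ) + 1)) * (A.card : ℝ) ^ 2 + 2 * (A.card * B.card)) =
            (A.card - (r + 1) * B.card : ℝ) ^ 2 / (((r : ℝ) + 1) * (r + 2)) := by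
          push_cast
          field_simp
          ring
        rw [this]
        positivity
      rw [hcard]
      nlinarith
    · refine ⟨fun _ => 0, ?_⟩
      have hW : W.filter (fun x => ¬ good x) = W := by
        apply Finset.filter_true_of_mem
        intro x hx hg
        exact hne ⟨x, Finset.mem_filter.2 ⟨hx, hg⟩⟩
      rw [hW] at hbad
      have h1 := adjPairs_le G W W
      have h2 := monoPairs_le G (fun _ => (0 : Fin (r + 1 + 1))) W
      have h3 : (W.card : ℝ) * W.card ≤ η / 6 * n * n := by gcongr
      have h4 : 0 ≤ (1 - 1 / (((r + 1 : ℕ) : ℝ) + 1)) * (W.card : ℝ) ^ 2 := by positivity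
      have h5 : 0 ≤ η * n ^ 2 := by positivity
      nlinarith

theorem pow_sum_div_card_le {ι : Type*} [Fintype ι] [Nonempty ι] (f : ι → ℝ) (hf : ∀ i, 0 ≤ f i)
    (k : ℕ) : ((∑ i, f i) / Fintype.card ι) ^ k ≤ (∑ i, f i ^ k) / Fintype.card ι := by
  have hc : (Fintype.card ι : ℝ) ≠ 0 := by simp
  have h := Real.pow_arith_mean_le_arith_mean_pow Finset.univ
    (fun _ : ι => (Fintype.card ι : ℝ)⁻¹) f (fun _ _ => by positivity) (by simp)
    (fun i _ => hf i) k
  rw [← Finset.mul_sum, ← Finset.mul_sum] at h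
  rwa [div_eq_inv_mul, div_eq_inv_mul]

theorem sum_cons {M X : Type*} [AddCommMonoid M] [Fintype X] {d : ℕ} (F : (Fin (d + 1) → X) → M) :
    ∑ x, F x = ∑ b : X, ∑ x : Fin d → X, F (Fin.cons b x) := by
  rw [← Fintype.sum_prod_type']
  exact (Fintype.sum_equiv (Fin.consEquiv fun _ => X) _ _ fun _ => rfl).symm

theorem prod_cons {M X : Type*} [CommMonoid M] [Fintype X] {d : ℕ} (F : (Fin (d + 1) → X) → M) :
    ∏ x, F x = ∏ b : X, ∏ x : Fin d → X, F (Fin.cons b x) := by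
  rw [← Fintype.prod_prod_type']
  exact (Fintype.prod_equiv (Fin.consEquiv fun _ => X) _ _ fun _ => rfl).symm

/-- The density of the `ι`-fold blow-ups of a dense `d`-partite weight is bounded from below. -/
theorem density_pow_le_blowup_density {X ι : Type*} [Fintype X] [Nonempty X] [Fintype ι]
    [DecidableEq ι] (d : ℕ) : ∀ R : (Fin d → X) → ℝ, (∀ x, 0 ≤ R x) →
    ((∑ x, R x) / (Fintype.card X : ℝ) ^ d) ^ Fintype.card ι ^ d ≤
      (∑ a : Fin d → ι → X, ∏ c : Fin d → ι, R fun i => a i (c i)) /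
        (Fintype.card X : ℝ) ^ (d * Fintype.card ι) := by
  induction d with
  | zero =>
    intro R _
    simp only [Nat.zero_mul, pow_zero, div_one, pow_one, Fintype.sum_unique, Fintype.prod_unique]
    exact le_of_eq (congrArg R (Subsingleton.elim _ _))
  | succ d ih =>
    intro R hR
    set n : ℝ := (Fintype.card X : ℝ) with hn
    have hn0 : 0 < n := by rw [hn]; exact_mod_cast Fintype.card_pos
    set m := Fintype.card ι with hm
    set S : (ι → X) → (Fin d → X) → ℝ := fun b x => ∏ j, R (Fin.cons (b j) x) with hS
    have hS0 : ∀ b x, 0 ≤ S b x := fun b x => Finset.prod_nonneg fun j _ => hR _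
    have h1 : ∑ a : Fin (d + 1) → ι → X, ∏ c : Fin (d + 1) → ι, R (fun i => a i (c i)) =
        ∑ b : ι → X, ∑ a : Fin d → ι → X, ∏ c : Fin d → ι, S b fun i => a i (c i) := by
      rw [sum_cons]
      refine Finset.sum_congr rfl fun b _ => Finset.sum_congr rfl fun a _ => ?_
      rw [prod_cons, Finset.prod_comm]
      refine Finset.prod_congr rfl fun c _ => Finset.prod_congr rfl fun j _ => congrArg R ?_
      funext i
      refine Fin.cases ?_ (fun i => ?_) i <;> simp
    have h2 : ∑ b, ∑ x, S b x = ∑ x : Fin d → X, (∑ y, R (Fin.cons y x)) ^ m := by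
      rw [Finset.sum_comm]
      refine Finset.sum_congr rfl fun x _ => ?_
      rw [hm, ← Finset.card_univ, ← Finset.prod_const, Finset.prod_univ_sum,
        Fintype.piFinset_univ]
    have h3 : ((∑ x, R x) / n ^ (d + 1)) ^ m ≤ (∑ b, (∑ x, S b x) / n ^ d) / n ^ m := by
      have := pow_sum_div_card_le (fun x : Fin d → X => (∑ y, R (Fin.cons y x)) / n)
        (fun x => div_nonneg (Finset.sum_nonneg fun _ _ => hR _) hn0.le) m
      rw [← Finset.sum_div, h2, sum_cons, Finset.sum_comm]
      simp only [div_pow, ← Finset.sum_div] at this ⊢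
      simp only [Fintype.card_fun, Fintype.card_fin] at this
      push_cast at this
      rw [← hn] at this
      convert this using 1
      · field_simp
        ring
      · field_simp
    have h4 := pow_sum_div_card_le (fun b : ι → X => (∑ x, S b x) / n ^ d)
      (fun b => div_nonneg (Finset.sum_nonneg fun _ _ => hS0 _ _) (by positivity)) (m ^ d)
    simp only [Fintype.card_fun] at h4
    push_cast at h4
    rw [← hn, ← hm] at h4
    rw [h1, pow_succ' m d, pow_mul]
    calc _ ≤ ((∑ b, (∑ x, S b x) / n ^ d) / n ^ m) ^ m ^ d := by
          exact pow_le_pow_left₀ (pow_nonneg (div_nonneg (Finset.sum_nonneg fun _ _ => hR _)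
            (by positivity)) _) h3 _
      _ ≤ (∑ b, ((∑ x, S b x) / n ^ d) ^ m ^ d) / n ^ m := h4
      _ ≤ (∑ b, (∑ a : Fin d → ι → X, ∏ c : Fin d → ι, S b fun i => a i (c i)) /
            n ^ (d * m)) / n ^ m := by
          gcongr with b
          exact ih (S b) (hS0 b)
      _ = _ := by
          rw [← Finset.sum_div, div_div, Nat.succ_mul, pow_add]

theorem cliqueTuples_eq_sum {X : Type*} [Fintype X] [DecidableEq X] (G : SimpleGraph X)
    [DecidableRel G.Adj] (d : ℕ) : ∀ W : Finset X, cliqueTuples G d W =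
      ∑ x : Fin d → X, if (∀ i, x i ∈ W) ∧ ∀ i j, i < j → G.Adj (x i) (x j) then 1 else 0 := by
  induction d with
  | zero => intro W; simp [cliqueTuples]
  | succ d ih =>
    intro W
    rw [cliqueTuples, sum_cons, ← Finset.sum_subset (Finset.subset_univ W)]
    · refine Finset.sum_congr rfl fun y hy => ?_
      rw [ih]
      refine Finset.sum_congr rfl fun x _ => ?_
      congr 1
      simp only [Fin.forall_fin_succ, Fin.cons_zero, Fin.cons_succ, Finset.mem_filter, hy,
        Fin.succ_lt_succ_iff, Fin.succ_pos, Fin.not_lt_zero, eq_iff_iff, forall_and]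
      tauto
    · intro y _ hy
      refine Finset.sum_eq_zero fun x _ => ?_
      rw [if_neg]
      intro h
      exact hy (by simpa using h.1 0)

open Classical in
/-- The injective homomorphisms from `H` to `G`. -/
noncomputable def injHoms {V X : Type*} [Fintype V] [Fintype X] (H : SimpleGraph V)
    (G : SimpleGraph X) : Finset (V → X) :=
  Finset.univ.filter fun f => Function.Injective f ∧ ∀ u v, H.Adj u v → G.Adj (f u) (f v)

theorem mem_injHoms {V X : Type*} [Fintype V] [Fintype X] {H : SimpleGraph V} {G : SimpleGraph X}
    {f : V → X} : f ∈ injHoms H G ↔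
      Function.Injective f ∧ ∀ u v, H.Adj u v → G.Adj (f u) (f v) := by
  simp [injHoms]

/-- A graph with many cliques of size `d` contains many homomorphic copies of every
`d`-colourable graph. -/
theorem card_homs_ge {V X : Type*} [Fintype V] [DecidableEq V] [Fintype X] [DecidableEq X]
    [Nonempty X] (H : SimpleGraph V) [DecidableRel H.Adj] (G : SimpleGraph X) [DecidableRel G.Adj]
    (d : ℕ) (col : H.Coloring (Fin d)) :
    ((cliqueTuples G d Finset.univ : ℝ) / (Fintype.card X : ℝ) ^ d) ^ Fintype.card V ^ d *
        (Fintype.card X : ℝ) ^ Fintype.card V ≤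
      ((Finset.univ.filter fun f : V → X => ∀ u v, H.Adj u v → G.Adj (f u) (f v)).card : ℝ) := by
  set n : ℝ := (Fintype.card X : ℝ) with hn
  have hn0 : 0 < n := by rw [hn]; exact_mod_cast Fintype.card_pos
  set R : (Fin d → X) → ℝ := fun x => if ∀ i j, i < j → G.Adj (x i) (x j) then 1 else 0 with hR
  have hR0 : ∀ x, 0 ≤ R x := fun x => by simp only [hR]; split_ifs <;> norm_num
  have h1 : (cliqueTuples G d Finset.univ : ℝ) = ∑ x, R x := by
    rw [cliqueTuples_eq_sum]
    simp [hR]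
  have h2 := density_pow_le_blowup_density (ι := V) d R hR0
  rw [← h1, ← hn] at h2
  set κ := {q : Fin d × V // q.1 ≠ col q.2}
  have hκ : Fintype.card κ + Fintype.card V = d * Fintype.card V := by
    have e : {q : Fin d × V // q.1 = col q.2} ≃ V :=
      { toFun := fun q => q.1.2
        invFun := fun v => ⟨(col v, v), rfl⟩
        left_inv := by rintro ⟨⟨i, v⟩, h⟩; exact Subtype.ext (Prod.ext h.symm rfl)
        right_inv := fun v => rfl }
    have h1 := Fintype.card_congr e
    have h2 := Fintype.card_subtype_compl (fun q : Fin d × V => q.1 = col q.2)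
    have h3 := Fintype.card_subtype_le (fun q : Fin d × V => q.1 = col q.2)
    rw [Fintype.card_prod, Fintype.card_fin] at h2 h3
    change Fintype.card {q : Fin d × V // ¬ q.1 = col q.2} + _ = _
    omega
  set good : Finset (Fin d → V → X) :=
    Finset.univ.filter fun a => ∀ u v, H.Adj u v → G.Adj (a (col u) u) (a (col v) v) with hgood
  have h3 : (∑ a : Fin d → V → X, ∏ c : Fin d → V, R fun i => a i (c i)) ≤ good.card := by
    rw [hgood, Finset.card_filter]
    push_cast
    refine Finset.sum_le_sum fun a _ => ?_
    split_ifs with h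
    · refine Finset.prod_le_one (fun _ _ => hR0 _) fun c _ => ?_
      simp only [hR]; split_ifs <;> norm_num
    · push Not at h
      obtain ⟨u, v, huv, hna⟩ := h
      refine le_of_eq (Finset.prod_eq_zero (Finset.mem_univ fun i => if i = col u then u else v) ?_)
      have hne : col u ≠ col v := col.valid huv
      simp only [hR]
      rw [if_neg]
      intro hall
      rcases lt_or_gt_of_ne hne with hlt | hlt
      · apply hna
        simpa [hne.symm] using hall _ _ hlt
      · apply hna
        simpa [hne.symm] using (hall _ _ hlt).symm
  have h4 : good.card ≤ (Finset.univ.filter fun f : V → X =>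
      ∀ u v, H.Adj u v → G.Adj (f u) (f v)).card * Fintype.card X ^ Fintype.card κ := by
    rw [← Fintype.card_fun, ← Finset.card_univ (α := κ → X), ← Finset.card_product]
    refine Finset.card_le_card_of_injOn
      (fun a => (fun v => a (col v) v, fun q : κ => a q.1.1 q.1.2)) ?_ ?_
    · intro a ha
      have ha := (Finset.mem_filter.1 ha).2
      simpa using ha
    · intro a _ b _ hab
      simp only [Prod.mk.injEq] at hab
      funext i v
      by_cases hi : i = col v
      · rw [hi]; exact congrFun hab.1 v
      · exact congrFun hab.2 ⟨(i, v), hi⟩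
  have h5 : (good.card : ℝ) ≤ (Finset.univ.filter fun f : V → X =>
      ∀ u v, H.Adj u v → G.Adj (f u) (f v)).card * n ^ Fintype.card κ := by
    rw [hn]; exact_mod_cast h4
  rw [← hκ, pow_add, le_div_iff₀ (by positivity)] at h2
  refine le_of_mul_le_mul_right ?_ (pow_pos hn0 (Fintype.card κ))
  calc _ = ((cliqueTuples G d Finset.univ : ℝ) / n ^ d) ^ Fintype.card V ^ d *
        (n ^ Fintype.card κ * n ^ Fintype.card V) := by ring
    _ ≤ _ := h2.trans (h3.trans h5)

theorem card_noninjective_le {V X : Type*} [Fintype V] [Fintype X] [DecidableEq X]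
    [DecidableEq V] (v : ℕ)
    (hv : Fintype.card V = v) (hX : v < Fintype.card X) :
    ((Finset.univ.filter fun f : V → X => ¬ Function.Injective f).card : ℝ) ≤
      (v : ℝ) ^ 2 / Fintype.card X * (Fintype.card X : ℝ) ^ v := by
  set n := Fintype.card X with hn
  have h1 : (Finset.univ.filter fun f : V → X => Function.Injective f).card =
      n.descFactorial v := by
    rw [← hv, hn, ← Fintype.card_embedding_eq, ← Fintype.card_subtype]
    exact Fintype.card_congr (Equiv.subtypeInjectiveEquivEmbedding V X)
  have h2 := Finset.card_filter_add_card_filter_not (s := (Finset.univ : Finset (V → X)))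
    (fun f => Function.Injective f)
  rw [h1, Finset.card_univ, Fintype.card_fun, hv, ← hn] at h2
  have h3 : ((n : ℝ) - v) ^ v ≤ (n.descFactorial v : ℝ) := by
    calc ((n : ℝ) - v) ^ v = ((n - v : ℕ) : ℝ) ^ v := by rw [Nat.cast_sub hX.le]
      _ ≤ ((n + 1 - v : ℕ) : ℝ) ^ v := by gcongr; omega
      _ ≤ _ := by exact_mod_cast Nat.pow_sub_le_descFactorial n v
  have hn0 : (0 : ℝ) < n := by exact_mod_cast (Nat.zero_le v).trans_lt hX
  have h4 : (1 - (v : ℝ) ^ 2 / n) * (n : ℝ) ^ v ≤ ((n : ℝ) - v) ^ v := by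
    have hvn : (v : ℝ) / n ≤ 1 := by
      rw [div_le_one hn0]; exact_mod_cast hX.le
    have := one_add_mul_le_pow (a := -((v : ℝ) / n)) (by linarith) v
    calc _ = (1 + (v : ℝ) * (-((v : ℝ) / n))) * (n : ℝ) ^ v := by ring
      _ ≤ (1 + -((v : ℝ) / n)) ^ v * (n : ℝ) ^ v := by gcongr
      _ = _ := by rw [← mul_pow]; congr 1; field_simp; ring
  have h5 : (n.descFactorial v : ℝ) +
      (Finset.univ.filter fun f : V → X => ¬ Function.Injective f).card = (n : ℝ) ^ v := by
    exact_mod_cast h2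
  linarith

/-- A graph with few copies of an `(r + 2)`-colourable graph `H` has an `(r + 1)`-colouring such
that the number of edges plus the number of monochromatic edges is essentially bounded by the
Turán number. -/
theorem exists_coloring_of_card_injHoms_lt {V : Type} [Fintype V] (H : SimpleGraph V) (r : ℕ)
    (hcol : H.Colorable (r + 2)) (η : ℝ) (hη : 0 < η) : ∃ γ : ℝ, 0 < γ ∧ ∃ n₀ : ℕ, ∀ n, n₀ ≤ n →
    ∀ (G : SimpleGraph (Fin n)) [DecidableRel G.Adj],
      ((injHoms H G).card : ℝ) < γ * (n : ℝ) ^ Fintype.card V →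
      ∃ c : Fin n → Fin (r + 1), adjPairs G Finset.univ Finset.univ +
        monoPairs G c Finset.univ ≤ (1 - 1 / ((r : ℝ) + 1)) * (n : ℝ) ^ 2 + η * (n : ℝ) ^ 2 := by
  classical
  obtain ⟨δ, hδ, hB⟩ := exists_coloring_of_cliqueTuples_le r η hη
  set v := Fintype.card V with hv
  set γ : ℝ := δ ^ v ^ (r + 2) with hγ
  have hγ0 : 0 < γ := by positivity
  obtain ⟨n₁, hn₁⟩ := exists_nat_gt ((v : ℝ) ^ 2 / (γ / 2))
  refine ⟨γ / 2, by positivity, max n₁ (v + 1), fun n hn G _ hG => ?_⟩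
  have hnv : v < n := le_of_max_le_right hn
  have hn0 : (0 : ℝ) < n := by exact_mod_cast (Nat.zero_le v).trans_lt hnv
  have hn1 : (n₁ : ℝ) ≤ n := by exact_mod_cast le_of_max_le_left hn
  have : Nonempty (Fin n) := ⟨⟨0, (Nat.zero_le v).trans_lt hnv⟩⟩
  suffices hfew : (cliqueTuples G (r + 2) Finset.univ : ℝ) ≤
      δ * (Fintype.card (Fin n) : ℝ) ^ (r + 2) by
    obtain ⟨c, hc⟩ := hB (Fin n) G Finset.univ hfew
    exact ⟨c, by simpa using hc⟩
  by_contra! hlt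
  have h1 := card_homs_ge H G (r + 2) hcol.some
  rw [Fintype.card_fin] at h1 hlt
  have h2 : γ * (n : ℝ) ^ v ≤ (Finset.univ.filter fun f : V → Fin n =>
      ∀ u v, H.Adj u v → G.Adj (f u) (f v)).card := by
    refine le_trans ?_ h1
    rw [← lt_div_iff₀ (by positivity)] at hlt
    rw [hγ]
    gcongr
  have h3 := card_noninjective_le (V := V) (X := Fin n) v rfl (by simpa using hnv)
  rw [Fintype.card_fin] at h3
  have h4 : (Finset.univ.filter fun f : V → Fin n => ∀ u v, H.Adj u v → G.Adj (f u) (f v)).card ≤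
      (injHoms H G).card +
        (Finset.univ.filter fun f : V → Fin n => ¬ Function.Injective f).card := by
    refine (Finset.card_le_card fun f hf => ?_).trans (Finset.card_union_le _ _)
    have hf := (Finset.mem_filter.1 hf).2
    by_cases hi : Function.Injective f
    · exact Finset.mem_union_left _ (mem_injHoms.2 ⟨hi, hf⟩)
    · exact Finset.mem_union_right _ (Finset.mem_filter.2 ⟨Finset.mem_univ _, hi⟩)
  have h5 : ((Finset.univ.filter fun f : V → Fin n =>
      ∀ u v, H.Adj u v → G.Adj (f u) (f v)).card : ℝ) ≤ (injHoms H G).card +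
        (Finset.univ.filter fun f : V → Fin n => ¬ Function.Injective f).card := by
    exact_mod_cast h4
  have h6 : (v : ℝ) ^ 2 / n * (n : ℝ) ^ v ≤ γ / 2 * (n : ℝ) ^ v := by
    refine mul_le_mul_of_nonneg_right ?_ (by positivity)
    rw [div_le_iff₀ hn0]
    rw [div_lt_iff₀ (by positivity)] at hn₁
    nlinarith
  linarith

/-- The vertices covered by a set of edges. -/
def edgeSpan {V : Type*} [DecidableEq V] (F : Finset (Sym2 V)) : Finset V :=
  F.biUnion Sym2.toFinset

theorem mem_edgeSpan {V : Type*} [DecidableEq V] {F : Finset (Sym2 V)} {v : V} :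
    v ∈ edgeSpan F ↔ ∃ e ∈ F, v ∈ e := by
  simp [edgeSpan]

theorem card_edgeSpan_le {V : Type*} [DecidableEq V] (F : Finset (Sym2 V)) :
    (edgeSpan F).card ≤ 2 * F.card := by
  rw [mul_comm]
  refine Finset.card_biUnion_le_card_mul _ _ _ fun e _ => ?_
  rw [Sym2.card_toFinset]
  split_ifs <;> norm_num

/-- The number of maps sending a prescribed number of edges onto `T`. -/
theorem card_injective_image_superset_le {V X : Type*} [Fintype V] [DecidableEq V] [Fintype X]
    [DecidableEq X] (E : Finset (Sym2 V)) (T : Finset (Sym2 X)) (m : ℝ)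
    (hm : 0 < m) (hE : ∀ F ⊆ E, F.Nonempty → (F.card : ℝ) - 1 ≤ m * ((edgeSpan F).card - 2))
    (hX : 0 < Fintype.card X) (hT : T.Nonempty) :
    ((Finset.univ.filter fun f : V → X => Function.Injective f ∧ T ⊆ E.image (Sym2.map f)).card
      : ℝ) ≤ 2 ^ E.card * (2 * E.card + 1 : ℝ) ^ Fintype.card V *
        ((Fintype.card X : ℝ) ^ Fintype.card V *
          ((Fintype.card X : ℝ) ^ (-(1 / m))) ^ (T.card - 1) / (Fintype.card X : ℝ) ^ 2) := by
  set n := Fintype.card X with hn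
  have hn1 : (1 : ℝ) ≤ n := by exact_mod_cast hX
  set maps : Finset (Sym2 V) → Finset (V → X) := fun F =>
    Fintype.piFinset fun v => if v ∈ edgeSpan F then edgeSpan T else Finset.univ with hmaps
  set 𝓕 := E.powerset.filter fun F => F.card = T.card with h𝓕
  have h1 : (Finset.univ.filter fun f : V → X => Function.Injective f ∧
      T ⊆ E.image (Sym2.map f)) ⊆
      if T.card ≤ E.card then 𝓕.biUnion maps else ∅ := by
    intro f hf
    obtain ⟨hfi, hfT⟩ := (Finset.mem_filter.1 hf).2
    have hinj := Sym2.map.injective hfi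
    rw [if_pos ((Finset.card_le_card hfT).trans Finset.card_image_le)]
    refine Finset.mem_biUnion.2 ⟨E.filter fun e => Sym2.map f e ∈ T, ?_, ?_⟩
    · refine Finset.mem_filter.2 ⟨Finset.mem_powerset.2 (Finset.filter_subset _ _), ?_⟩
      rw [← Finset.card_image_of_injective _ hinj]
      congr 1
      ext e
      simp only [Finset.mem_image, Finset.mem_filter]
      constructor
      · rintro ⟨a, ⟨_, h⟩, rfl⟩; exact h
      · intro he
        obtain ⟨a, ha, rfl⟩ := Finset.mem_image.1 (hfT he)
        exact ⟨a, ⟨ha, he⟩, rfl⟩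
    · refine Fintype.mem_piFinset.2 fun v => ?_
      split_ifs with hv
      · obtain ⟨e, he, hve⟩ := mem_edgeSpan.1 hv
        exact mem_edgeSpan.2 ⟨_, (Finset.mem_filter.1 he).2, Sym2.mem_map.2 ⟨v, hve, rfl⟩⟩
      · exact Finset.mem_univ _
  have h2 : ∀ F ∈ 𝓕, T.card ≤ E.card → ((maps F).card : ℝ) ≤
      (2 * E.card + 1 : ℝ) ^ Fintype.card V *
        ((n : ℝ) ^ Fintype.card V * ((n : ℝ) ^ (-(1 / m))) ^ (T.card - 1) / (n : ℝ) ^ 2) := by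
    intro F hF hTE
    obtain ⟨hFE, hFT⟩ := Finset.mem_filter.1 hF
    rw [Finset.mem_powerset] at hFE
    have hTpos := hT.card_pos
    have hFne : F.Nonempty := Finset.card_pos.1 (by omega)
    have hc : (maps F).card = (edgeSpan T).card ^ (edgeSpan F).card *
        n ^ (Fintype.card V - (edgeSpan F).card) := by
      rw [hmaps, Fintype.card_piFinset]
      simp only [apply_ite Finset.card]
      rw [Finset.prod_ite, Finset.prod_const, Finset.prod_const, Finset.card_univ,
        Finset.filter_mem_eq_inter, Finset.univ_inter, ← hn]
      congr 2
      rw [← Finset.card_compl]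
      congr 1
      ext; simp
    have hV : (edgeSpan F).card ≤ Fintype.card V := Finset.card_le_univ _
    rw [hc]
    push_cast
    have h3 : ((edgeSpan T).card : ℝ) ^ (edgeSpan F).card ≤
        (2 * E.card + 1 : ℝ) ^ Fintype.card V := by
      calc _ ≤ (2 * E.card + 1 : ℝ) ^ (edgeSpan F).card := by
            gcongr
            have := card_edgeSpan_le T
            exact_mod_cast (by omega : (edgeSpan T).card ≤ 2 * E.card + 1)
        _ ≤ _ := by
            refine pow_le_pow_right₀ ?_ hV
            linarith [(Nat.cast_nonneg E.card : (0 : ℝ) ≤ E.card)]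
    have h4 : (n : ℝ) ^ (Fintype.card V - (edgeSpan F).card) ≤
        (n : ℝ) ^ Fintype.card V * ((n : ℝ) ^ (-(1 / m))) ^ (T.card - 1) / (n : ℝ) ^ 2 := by
      rw [← Real.rpow_natCast, ← Real.rpow_natCast (n : ℝ) (Fintype.card V),
        ← Real.rpow_natCast _ (T.card - 1), ← Real.rpow_natCast (n : ℝ) 2, ← Real.rpow_mul
        (by positivity), ← Real.rpow_add (by positivity), ← Real.rpow_sub (by positivity)]
      refine Real.rpow_le_rpow_of_exponent_le hn1 ?_
      have h5 := hE F hFE hFne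
      rw [hFT] at h5
      rw [Nat.cast_sub hV, Nat.cast_sub hTpos]
      push_cast
      have h6 : ((T.card : ℝ) - 1) / m ≤ (edgeSpan F).card - 2 := by
        rw [div_le_iff₀ hm]; linarith
      have h7 : -(1 / m) * ((T.card : ℝ) - 1) = -(((T.card : ℝ) - 1) / m) := by ring
      linarith
    gcongr
  have h3 := Finset.card_le_card h1
  split_ifs at h3 with hTE
  · calc _ ≤ ((𝓕.biUnion maps).card : ℝ) := by exact_mod_cast h3
      _ ≤ ∑ F ∈ 𝓕, ((maps F).card : ℝ) := by exact_mod_cast Finset.card_biUnion_le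
      _ ≤ ∑ F ∈ 𝓕, ((2 * E.card + 1 : ℝ) ^ Fintype.card V *
        ((n : ℝ) ^ Fintype.card V * ((n : ℝ) ^ (-(1 / m))) ^ (T.card - 1) / (n : ℝ) ^ 2)) :=
          Finset.sum_le_sum fun F hF => h2 F hF hTE
      _ ≤ _ := by
        rw [Finset.sum_const, nsmul_eq_mul, mul_assoc]
        gcongr
        have : 𝓕.card ≤ 2 ^ E.card := by
          rw [← Finset.card_powerset]; exact Finset.card_filter_le _ _
        exact_mod_cast this
  · rw [Finset.card_empty, Nat.le_zero] at h3
    rw [h3]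
    push_cast
    positivity

theorem card_sym2_fin_le (n : ℕ) : (Fintype.card (Sym2 (Fin n)) : ℝ) ≤ (n : ℝ) ^ 2 := by
  rw [Sym2.card, Fintype.card_fin, Nat.choose_two_right]
  have : (n + 1) * (n + 1 - 1) / 2 ≤ n ^ 2 := by
    rw [Nat.add_sub_cancel]
    exact Nat.div_le_of_le_mul (by nlinarith)
  exact_mod_cast this

/-- The container theorem for the edge sets of `H`-free graphs. -/
theorem exists_containerCover_injHoms {V : Type} [Fintype V] [DecidableEq V] (H : SimpleGraph V)
    [DecidableRel H.Adj] (hH : 0 < H.edgeFinset.card) (m : ℝ) (hm : 0 < m)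
    (hE : ∀ F ⊆ H.edgeFinset, F.Nonempty → (F.card : ℝ) - 1 ≤ m * ((edgeSpan F).card - 2))
    (γ : ℝ) (hγ : 0 < γ) :
    ∃ L : ℕ, ∀ n : ℕ, 0 < n → ContainerCover L ((n : ℝ) ^ (-(1 / m)) * (n : ℝ) ^ 2)
      (fun I : Finset (Sym2 (Fin n)) =>
        injHoms H (SimpleGraph.fromEdgeSet (I : Set (Sym2 (Fin n)))) = ∅)
      (fun C => ((injHoms H (SimpleGraph.fromEdgeSet (C : Set (Sym2 (Fin n))))).card : ℝ) <
        γ * (n : ℝ) ^ Fintype.card V) := by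
  obtain ⟨k, hk⟩ := Nat.exists_eq_succ_of_ne_zero hH.ne'
  set K₀ : ℝ := 2 ^ H.edgeFinset.card * (2 * H.edgeFinset.card + 1 : ℝ) ^ Fintype.card V with hK₀
  have hK₀pos : 0 < K₀ := by positivity
  obtain ⟨L, hL⟩ := exists_containerCover k (K₀ / γ) (by positivity)
  refine ⟨L, fun n hn => hL _ _ _ _ _ (by positivity) (by positivity) ?_ ?_ ?_⟩
  · exact card_sym2_fin_le n
  · intro I J hJI hI
    rw [Finset.eq_empty_iff_forall_notMem] at hI ⊢
    intro f hf
    rw [mem_injHoms] at hf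
    refine hI f (mem_injHoms.2 ⟨hf.1, fun u v huv => ?_⟩)
    exact SimpleGraph.fromEdgeSet_mono (Finset.coe_subset.2 hJI) (hf.2 u v huv)
  · intro C hC
    rw [not_lt] at hC
    set S := injHoms H (SimpleGraph.fromEdgeSet (C : Set (Sym2 (Fin n)))) with hS
    have hSpos : (0 : ℝ) < S.card := lt_of_lt_of_le (by positivity) hC
    set im : (V → Fin n) → Finset (Sym2 (Fin n)) := fun f => H.edgeFinset.image (Sym2.map f)
      with him
    have hne : ∀ E, ((S.filter fun f => im f = E).card : ℝ) / S.card ≠ 0 → ∃ f ∈ S, im f = E := by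
      intro E hE
      by_contra! hnone
      rw [Finset.filter_false_of_mem hnone] at hE
      simp at hE
    have hsum : ∀ 𝒯 : Finset (Finset (Sym2 (Fin n))),
        ∑ E ∈ 𝒯, ((S.filter fun f => im f = E).card : ℝ) / S.card =
        ((S.filter fun f => im f ∈ 𝒯).card : ℝ) / S.card := by
      intro 𝒯
      rw [← Finset.sum_div, ← Finset.sum_card_fiberwise_eq_card_filter]
      push_cast
      rfl
    refine ⟨fun E => ((S.filter fun f => im f = E).card : ℝ) / S.card, ⟨?_, ?_, ?_⟩, ?_, ?_⟩
    · intro E; positivity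
    · intro E hE
      obtain ⟨f, hf, rfl⟩ := hne E hE
      rw [him, Finset.card_image_of_injective _ (Sym2.map.injective (mem_injHoms.1 hf).1), hk]
    · intro T hT
      have h1 := card_injective_image_superset_le (X := Fin n) H.edgeFinset T m hm hE
        (by simpa using hn) hT
      rw [← hK₀, Fintype.card_fin] at h1
      rw [weightDegree, hsum]
      have h2 : ((S.filter fun f => im f ∈ Finset.univ.filter fun E => T ⊆ E).card : ℝ) ≤
          (Finset.univ.filter fun f : V → Fin n =>
            Function.Injective f ∧ T ⊆ H.edgeFinset.image (Sym2.map f)).card := by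
        norm_cast
        refine Finset.card_le_card fun f hf => ?_
        obtain ⟨hfS, hfT⟩ := Finset.mem_filter.1 hf
        exact Finset.mem_filter.2 ⟨Finset.mem_univ _, (mem_injHoms.1 hfS).1,
          (Finset.mem_filter.1 hfT).2⟩
      rw [div_le_iff₀ hSpos]
      refine (h2.trans h1).trans ?_
      calc _ = K₀ / γ * ((n : ℝ) ^ (-(1 / m))) ^ (T.card - 1) / (n : ℝ) ^ 2 *
            (γ * (n : ℝ) ^ Fintype.card V) := by field_simp
        _ ≤ _ := by gcongr
    · rw [hsum]
      simp [hSpos.ne']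
    · intro E hE
      obtain ⟨f, hf, rfl⟩ := hne E hE
      rw [mem_injHoms] at hf
      refine ⟨?_, fun I hI hsub => ?_⟩
      · intro e he
        obtain ⟨a, ha, rfl⟩ := Finset.mem_image.1 he
        induction a with
        | _ u v =>
        have := hf.2 u v (by simpa using ha)
        exact (SimpleGraph.fromEdgeSet_adj _).1 this |>.1
      · rw [Finset.eq_empty_iff_forall_notMem] at hI
        refine hI f (mem_injHoms.2 ⟨hf.1, fun u v huv => ?_⟩)
        refine (SimpleGraph.fromEdgeSet_adj _).2 ⟨?_, fun h => huv.ne (hf.1 h)⟩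
        exact hsub (Finset.mem_image.2 ⟨s(u, v), by simpa using huv, rfl⟩)

section TwoDensity

variable {V : Type*} [Fintype V] [DecidableEq V] (H : SimpleGraph V) [DecidableRel H.Adj]

theorem three_le_card_edgeSpan {F : Finset (Sym2 V)} (hF : F ⊆ H.edgeFinset)
    (h : 2 ≤ F.card) : 3 ≤ (edgeSpan F).card := by
  by_contra! hlt
  have hspan : ∀ e ∈ F, e.toFinset = edgeSpan F := by
    intro e he
    refine Finset.eq_of_subset_of_card_le (Finset.subset_biUnion_of_mem Sym2.toFinset he) ?_
    rw [Sym2.card_toFinset_of_not_isDiag _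
      (H.not_isDiag_of_mem_edgeSet (SimpleGraph.mem_edgeFinset.1 (hF he)))]
    omega
  obtain ⟨e, he, e', he', hne⟩ := Finset.one_lt_card.1 h
  refine hne (Sym2.ext fun v => ?_)
  rw [← Sym2.mem_toFinset, ← Sym2.mem_toFinset, hspan e he, hspan e' he']

theorem exists_subgraph_of_edges {F : Finset (Sym2 V)} (hF : F ⊆ H.edgeFinset) :
    ∃ S : H.Subgraph, Nat.card S.edgeSet = F.card ∧ Nat.card S.verts = (edgeSpan F).card := by
  refine ⟨⟨edgeSpan F, fun u v => s(u, v) ∈ F, fun h => by simpa using hF h,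
    fun h => mem_edgeSpan.2 ⟨_, h, Sym2.mem_mk_left _ _⟩,
    ⟨fun u v h => by rwa [Sym2.eq_swap]⟩⟩, ?_, ?_⟩
  · have h : SimpleGraph.Subgraph.edgeSet (⟨edgeSpan F, fun u v => s(u, v) ∈ F,
        fun h => by simpa using hF h, fun h => mem_edgeSpan.2 ⟨_, h, Sym2.mem_mk_left _ _⟩,
        ⟨fun u v h => by rwa [Sym2.eq_swap]⟩⟩ : H.Subgraph) = (F : Set (Sym2 V)) := by
      ext e
      induction e with
      | _ u v => rfl
    rw [h, Nat.card_coe_set_eq, Set.ncard_coe_finset]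
  · rw [Nat.card_coe_set_eq, Set.ncard_coe_finset]

theorem card_sub_one_le_twoDensity {F : Finset (Sym2 V)} (hF : F ⊆ H.edgeFinset)
    (hne : F.Nonempty) : (F.card : ℝ) - 1 ≤ twoDensity H * ((edgeSpan F).card - 2) := by
  rcases (Nat.one_le_iff_ne_zero.2 hne.card_pos.ne').eq_or_lt with h1 | h2
  · obtain ⟨e, rfl⟩ := Finset.card_eq_one.1 h1.symm
    have : (edgeSpan {e}).card = 2 := by
      rw [edgeSpan, Finset.singleton_biUnion]
      exact Sym2.card_toFinset_of_not_isDiag _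
        (H.not_isDiag_of_mem_edgeSet (SimpleGraph.mem_edgeFinset.1 (hF (by simp))))
    simp [this]
  · have h3 := three_le_card_edgeSpan H hF h2
    have h3' : (3 : ℝ) ≤ (edgeSpan F).card := by exact_mod_cast h3
    obtain ⟨S, hS, hS'⟩ := exists_subgraph_of_edges H hF
    rw [← div_le_iff₀ (by linarith)]
    refine le_csSup (Set.Finite.bddAbove ?_) ⟨S, by omega, by rw [hS, hS']⟩
    refine (Set.finite_range fun S : H.Subgraph =>
      ((Nat.card S.edgeSet : ℝ) - 1) / ((Nat.card S.verts : ℝ) - 2)).subset ?_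
    rintro _ ⟨S, _, rfl⟩
    exact ⟨S, rfl⟩

theorem exists_adj_adj_of_not_colorable_two (h : ¬ H.Colorable 2) :
    ∃ u v w, H.Adj u v ∧ H.Adj u w ∧ v ≠ w := by
  by_contra! hno
  apply h
  let e := Fintype.equivFin V
  refine ⟨SimpleGraph.Coloring.mk (fun u => if ∃ v, H.Adj u v ∧ e u < e v then 0 else 1) ?_⟩
  have key : ∀ u v, H.Adj u v → e u < e v →
      (if ∃ w, H.Adj u w ∧ e u < e w then (0 : Fin 2) else 1) ≠
        if ∃ w, H.Adj v w ∧ e v < e w then 0 else 1 := by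
    intro u v huv hlt
    rw [if_pos ⟨v, huv, hlt⟩, if_neg]
    · norm_num
    · rintro ⟨w, hvw, hlt'⟩
      rw [hno v w u hvw huv.symm] at hlt'
      exact lt_asymm hlt hlt'
  intro u v huv
  rcases lt_or_gt_of_ne (e.injective.ne huv.ne) with hlt | hlt
  · exact key u v huv hlt
  · exact (key v u huv.symm hlt).symm

theorem one_le_twoDensity (h : ¬ H.Colorable 2) : 1 ≤ twoDensity H := by
  obtain ⟨u, v, w, huv, huw, hvw⟩ := exists_adj_adj_of_not_colorable_two H h
  have hne : s(u, v) ≠ s(u, w) := by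
    intro heq
    exact hvw (Sym2.congr_right.1 heq)
  have h1 := card_sub_one_le_twoDensity H (F := {s(u, v), s(u, w)})
    (by intro e he; simp at he; rcases he with rfl | rfl <;> simpa) (by simp)
  have h2 : edgeSpan {s(u, v), s(u, w)} = ({u, v, w} : Finset V) := by
    ext x; simp [mem_edgeSpan]; tauto
  rw [h2, Finset.card_pair hne, Finset.card_eq_three.2 ⟨u, v, w, huv.ne, huw.ne, hvw, rfl⟩] at h1
  norm_num at h1
  exact h1

end TwoDensity

theorem isProbabilityMeasure_bern {p : ℝ} (h0 : 0 ≤ p) (h1 : p ≤ 1) :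
    IsProbabilityMeasure (bern p) := by
  constructor
  simp only [bern, Measure.coe_add, Measure.coe_smul, Pi.add_apply, Pi.smul_apply,
    measure_univ, smul_eq_mul, mul_one]
  rw [← ENNReal.ofReal_add h0 (by linarith)]
  simp

theorem isProbabilityMeasure_gnp (n : ℕ) {p : ℝ} (h0 : 0 ≤ p) (h1 : p ≤ 1) :
    IsProbabilityMeasure (gnp n p) := by
  have := isProbabilityMeasure_bern h0 h1
  unfold gnp
  infer_instance

theorem integral_bern {p : ℝ} (h0 : 0 ≤ p) (h1 : p ≤ 1) (f : Bool → ℝ) :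
    ∫ x, f x ∂bern p = p * f true + (1 - p) * f false := by
  unfold bern
  rw [integral_add_measure (Integrable.of_finite.smul_measure (by simp))
    (Integrable.of_finite.smul_measure (by simp)), integral_smul_measure, integral_smul_measure,
    integral_dirac, integral_dirac, ENNReal.toReal_ofReal h0,
    ENNReal.toReal_ofReal (by linarith)]
  simp

/-- The number of present pairs among `D`. -/
def presentCount {α : Type*} (ω : α → Bool) (D : Finset α) : ℕ := (D.filter fun e => ω e = true).card

theorem exp_sub_one_sub_le_sq {x : ℝ} (hx : |x| ≤ 1) : Real.exp x - 1 ≤ x + x ^ 2 := by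
  have := (abs_le.1 (Real.abs_exp_sub_one_sub_id_le hx)).2
  linarith

/-- A joint Chernoff bound for the presence of all pairs in `S` and a deviation of the number of
present pairs in a set `D` disjoint from `S`. -/
theorem gnp_real_le {n : ℕ} {p : ℝ} (h0 : 0 ≤ p) (h1 : p ≤ 1) (S D : Finset (Sym2 (Fin n)))
    (hSD : Disjoint S D) (N l t : ℝ) (hN : (D.card : ℝ) ≤ N) (hl : |l| ≤ 1) :
    (gnp n p).real {ω | (∀ e ∈ S, ω e = true) ∧ t ≤ l * (presentCount ω D - p * D.card)} ≤
      p ^ S.card * Real.exp (l ^ 2 * p * N - t) := by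
  have hprob := isProbabilityMeasure_gnp n h0 h1
  have hb := isProbabilityMeasure_bern h0 h1
  set F : Sym2 (Fin n) → Bool → ℝ := fun e b =>
    if e ∈ S then (if b then 1 else 0) else if e ∈ D then (if b then Real.exp l else 1) else 1
    with hF
  set A : Set (Sym2 (Fin n) → Bool) :=
    {ω | (∀ e ∈ S, ω e = true) ∧ t ≤ l * (presentCount ω D - p * D.card)} with hA
  have hF0 : ∀ e b, 0 ≤ F e b := by
    intro e b; simp only [hF]; split_ifs <;> positivity
  have hint : ∫ ω, ∏ e, F e (ω e) ∂gnp n p = p ^ S.card * (1 + p * (Real.exp l - 1)) ^ D.card := by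
    unfold gnp
    rw [integral_fintype_prod_eq_prod]
    simp only [integral_bern h0 h1]
    have : ∀ e, p * F e true + (1 - p) * F e false =
        (if e ∈ S then p else 1) * (if e ∈ D then 1 + p * (Real.exp l - 1) else 1) := by
      intro e
      simp only [hF]
      by_cases hS : e ∈ S
      · simp [hS, Finset.disjoint_left.1 hSD hS]
      · by_cases hD : e ∈ D
        · simp [hS, hD]; ring
        · simp [hS, hD]
    simp only [this, Finset.prod_mul_distrib]
    rw [Finset.prod_ite_mem, Finset.prod_ite_mem]
    simp
  have hpt : ∀ ω, A.indicator (fun _ => (1 : ℝ)) ω ≤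
      Real.exp (-(t + l * p * D.card)) * ∏ e, F e (ω e) := by
    intro ω
    by_cases hω : ω ∈ A
    · rw [Set.indicator_of_mem hω]
      obtain ⟨hS, hD⟩ := hω
      have h2 : ∏ e, F e (ω e) = Real.exp (l * presentCount ω D) := by
        have : ∀ e, F e (ω e) =
            if e ∈ D.filter (fun e => ω e = true) then Real.exp l else 1 := by
          intro e
          by_cases he : e ∈ S
          · simp [hF, he, hS e he, Finset.disjoint_left.1 hSD he]
          · by_cases hD : e ∈ D <;> by_cases hb : ω e = true <;> simp [hF, he, hD, hb]
        simp only [this]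
        rw [Finset.prod_ite_mem, Finset.univ_inter, Finset.prod_const, presentCount,
          ← Real.exp_nat_mul, mul_comm]
      rw [h2, ← Real.exp_add]
      refine Real.one_le_exp ?_
      linarith
    · rw [Set.indicator_of_notMem hω]
      exact mul_nonneg (Real.exp_pos _).le (Finset.prod_nonneg fun _ _ => hF0 _ _)
  have hmeas : MeasurableSet A := (Set.toFinite A).measurableSet
  calc (gnp n p).real A = ∫ ω, A.indicator (fun _ => (1 : ℝ)) ω ∂gnp n p := by
        rw [integral_indicator_const _ hmeas]; simp
    _ ≤ ∫ ω, Real.exp (-(t + l * p * D.card)) * ∏ e, F e (ω e) ∂gnp n p :=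
        integral_mono Integrable.of_finite Integrable.of_finite hpt
    _ = Real.exp (-(t + l * p * D.card)) *
        (p ^ S.card * (1 + p * (Real.exp l - 1)) ^ D.card) := by
        rw [integral_const_mul, hint]
    _ ≤ Real.exp (-(t + l * p * D.card)) *
        (p ^ S.card * Real.exp (p * (l + l ^ 2)) ^ D.card) := by
        have h3 := exp_sub_one_sub_le_sq hl
        have h4 : p * (Real.exp l - 1) ≤ p * (l + l ^ 2) := by gcongr
        have h5 := Real.add_one_le_exp (p * (l + l ^ 2))
        have h6 : 0 ≤ 1 + p * (Real.exp l - 1) := by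
          have := (Real.exp_pos l).le
          nlinarith
        gcongr
        linarith
    _ = p ^ S.card * Real.exp (l ^ 2 * p * D.card - t) := by
        rw [← Real.exp_nat_mul, mul_left_comm, ← Real.exp_add]
        congr 2
        ring
    _ ≤ _ := by gcongr

section Colorings

variable {n r : ℕ}

/-- The pairs of vertices receiving distinct colours. -/
def crossPairs (c : Fin n → Fin r) : Finset (Sym2 (Fin n)) :=
  Finset.univ.filter fun e => ¬ (Sym2.map c e).IsDiag

/-- The pairs of distinct vertices in `C`. -/
def properPairs (C : Finset (Sym2 (Fin n))) : Finset (Sym2 (Fin n)) :=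
  C.filter fun e => ¬ e.IsDiag

/-- The monochromatic pairs of distinct vertices in `C`. -/
def innerPairs (c : Fin n → Fin r) (C : Finset (Sym2 (Fin n))) : Finset (Sym2 (Fin n)) :=
  C.filter fun e => ¬ e.IsDiag ∧ (Sym2.map c e).IsDiag

theorem mk_mem_crossPairs {c : Fin n → Fin r} {u v : Fin n} :
    s(u, v) ∈ crossPairs c ↔ c u ≠ c v := by
  simp [crossPairs]

theorem two_mul_card_eq_sum (E : Finset (Sym2 (Fin n))) (hE : ∀ e ∈ E, ¬ e.IsDiag) :
    2 * (E.card : ℝ) = ∑ x, ∑ y, if s(x, y) ∈ E then (1 : ℝ) else 0 := by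
  classical
  obtain ⟨G, hG⟩ : ∃ G, G = SimpleGraph.fromEdgeSet (E : Set (Sym2 (Fin n))) := ⟨_, rfl⟩
  have h := G.sum_degrees_eq_twice_card_edges
  have h1 : G.edgeFinset = E := by
    ext e
    rw [SimpleGraph.mem_edgeFinset, hG, SimpleGraph.edgeSet_fromEdgeSet]
    exact ⟨fun h => h.1, fun h => ⟨h, hE e h⟩⟩
  rw [h1] at h
  have h2 : (2 : ℝ) * E.card = ((2 * E.card : ℕ) : ℝ) := by push_cast; ring
  rw [h2, ← h]
  push_cast
  refine Finset.sum_congr rfl fun x _ => ?_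
  rw [← SimpleGraph.card_neighborFinset_eq_degree, SimpleGraph.neighborFinset_eq_filter,
    Finset.card_filter]
  push_cast
  refine Finset.sum_congr rfl fun y _ => ?_
  congr 1
  simp only [hG, SimpleGraph.fromEdgeSet_adj, Finset.mem_coe, eq_iff_iff]
  refine ⟨fun h => h.1, fun h => ⟨h, fun hxy => hE _ h (by simpa using hxy)⟩⟩

theorem two_mul_card_crossPairs (c : Fin n → Fin r) :
    2 * ((crossPairs c).card : ℝ) =
      (n : ℝ) ^ 2 - ∑ i, ((Finset.univ.filter fun v => c v = i).card : ℝ) ^ 2 := by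
  rw [two_mul_card_eq_sum _ fun e he => by
    induction e with
    | _ u v =>
      have := mk_mem_crossPairs.1 he
      intro h
      exact this (congrArg c (by simpa using h))]
  simp only [mk_mem_crossPairs]
  have h1 : ∀ x y : Fin n, (if c x ≠ c y then (1 : ℝ) else 0) =
      1 - ∑ i, (if c x = i then (1 : ℝ) else 0) * (if c y = i then 1 else 0) := by
    intro x y
    rw [Finset.sum_eq_single (c x)]
    · by_cases h : c x = c y <;> simp [h, eq_comm]
    · intro i _ hi; simp [hi.symm]
    · simp
  simp only [h1, Finset.sum_sub_distrib]
  congr 1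
  · simp [sq]
  · simp_rw [Finset.sum_comm (s := Finset.univ (α := Fin n)) (t := Finset.univ (α := Fin r))]
    refine Finset.sum_congr rfl fun i _ => ?_
    rw [← Finset.sum_mul_sum, sq]
    simp

theorem adjPairs_fromEdgeSet (C : Finset (Sym2 (Fin n)))
    [DecidableRel (SimpleGraph.fromEdgeSet (C : Set (Sym2 (Fin n)))).Adj] :
    adjPairs (SimpleGraph.fromEdgeSet (C : Set (Sym2 (Fin n)))) Finset.univ Finset.univ =
      2 * ((properPairs C).card : ℝ) := by
  rw [two_mul_card_eq_sum (properPairs C) fun e he => (Finset.mem_filter.1 he).2]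
  refine Finset.sum_congr rfl fun x _ => Finset.sum_congr rfl fun y _ => ?_
  congr 1
  simp [properPairs]

theorem monoPairs_fromEdgeSet (c : Fin n → Fin r) (C : Finset (Sym2 (Fin n)))
    [DecidableRel (SimpleGraph.fromEdgeSet (C : Set (Sym2 (Fin n)))).Adj] :
    monoPairs (SimpleGraph.fromEdgeSet (C : Set (Sym2 (Fin n)))) c Finset.univ =
      2 * ((innerPairs c C).card : ℝ) := by
  rw [two_mul_card_eq_sum (innerPairs c C) fun e he => (Finset.mem_filter.1 he).2.1]
  refine Finset.sum_congr rfl fun x _ => Finset.sum_congr rfl fun y _ => ?_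
  congr 1
  simp [innerPairs, and_assoc]

/-- The colouring of the vertices by their residues modulo `r`. -/
def residueColoring (n : ℕ) (hr : 0 < r) : Fin n → Fin r := fun v => ⟨v % r, Nat.mod_lt _ hr⟩

theorem card_residue_le (hr : 0 < r) (i : Fin r) :
    (Finset.univ.filter fun v => residueColoring n hr v = i).card ≤ n / r + 1 := by
  rw [← Finset.card_range (n / r + 1)]
  refine Finset.card_le_card_of_injOn (fun v => (v : ℕ) / r) ?_ ?_
  · intro v _
    simpa [Nat.lt_succ_iff] using Nat.div_le_div_right v.2.le
  · intro v hv w hw h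
    have hv := congrArg Fin.val (Finset.mem_filter.1 hv).2
    have hw := congrArg Fin.val (Finset.mem_filter.1 hw).2
    simp only [residueColoring] at hv hw h
    apply Fin.ext
    rw [← Nat.div_add_mod v r, ← Nat.div_add_mod w r, h, hv, hw]

theorem sum_card_color_classes (c : Fin n → Fin r) :
    ∑ i, ((Finset.univ.filter fun v => c v = i).card : ℝ) = n := by
  have := Finset.card_eq_sum_card_fiberwise (f := c) (s := Finset.univ) (t := Finset.univ)
    (fun _ _ => by simp)
  rw [Finset.card_univ, Fintype.card_fin] at this
  exact_mod_cast this.symm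

theorem le_card_crossPairs_residueColoring (hr : 0 < r) :
    (1 - 1 / (r : ℝ)) * (n : ℝ) ^ 2 - n ≤ 2 * ((crossPairs (residueColoring n hr)).card : ℝ) := by
  rw [two_mul_card_crossPairs]
  have h : ∑ i, ((Finset.univ.filter fun v => residueColoring n hr v = i).card : ℝ) ^ 2 ≤
      ((n : ℝ) / r + 1) * n := by
    calc _ ≤ ∑ i, ((n : ℝ) / r + 1) *
          ((Finset.univ.filter fun v => residueColoring n hr v = i).card : ℝ) := by
          refine Finset.sum_le_sum fun i _ => ?_
          rw [sq]
          refine mul_le_mul_of_nonneg_right ?_ (by positivity)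
          calc _ ≤ ((n / r + 1 : ℕ) : ℝ) := by exact_mod_cast card_residue_le hr i
            _ ≤ _ := by
              push_cast
              have := Nat.cast_div_le (α := ℝ) (m := n) (n := r)
              linarith
      _ = _ := by rw [← Finset.mul_sum, sum_card_color_classes]
  have h2 : ((n : ℝ) / r + 1) * n = 1 / r * (n : ℝ) ^ 2 + n := by ring
  linarith

theorem abs_card_color_class_sub_le (hr : 0 < r) (c : Fin n → Fin r) (κ : ℝ)
    (h : (1 - 1 / (r : ℝ)) * (n : ℝ) ^ 2 - κ ^ 2 ≤ 2 * ((crossPairs c).card : ℝ)) (hκ : 0 ≤ κ)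
    (i : Fin r) : |((Finset.univ.filter fun v => c v = i).card : ℝ) - n / r| ≤ κ := by
  rw [two_mul_card_crossPairs] at h
  have hr' : (0 : ℝ) < r := by exact_mod_cast hr
  have h1 : ∑ i, (((Finset.univ.filter fun v => c v = i).card : ℝ) - n / r) ^ 2 =
      ∑ i, ((Finset.univ.filter fun v => c v = i).card : ℝ) ^ 2 - 1 / r * (n : ℝ) ^ 2 := by
    simp only [sub_sq, Finset.sum_add_distrib, Finset.sum_sub_distrib, ← Finset.sum_mul,
      ← Finset.mul_sum, sum_card_color_classes]
    simp
    field_simp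
    ring
  refine abs_le_of_sq_le_sq ?_ hκ
  calc _ ≤ ∑ i, (((Finset.univ.filter fun v => c v = i).card : ℝ) - n / r) ^ 2 :=
        Finset.single_le_sum (f := fun i =>
          (((Finset.univ.filter fun v => c v = i).card : ℝ) - n / r) ^ 2)
          (fun _ _ => sq_nonneg _) (Finset.mem_univ i)
    _ ≤ _ := by linarith

theorem exists_coloring_of_isCut {P : Fin r → Finset (Fin n)} (hP : IsCut P) :
    ∃ c : Fin n → Fin r, P = fun i => Finset.univ.filter fun v => c v = i := by
  choose c hc using hP.2
  refine ⟨c, funext fun i => Finset.ext fun v => ?_⟩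
  simp only [Finset.mem_filter, Finset.mem_univ, true_and]
  refine ⟨fun hv => ?_, fun h => h ▸ hc v⟩
  by_contra hne
  exact Finset.disjoint_left.1 (hP.1 _ _ hne) (hc v) hv

theorem isCut_color_classes (c : Fin n → Fin r) :
    IsCut fun i => Finset.univ.filter fun v => c v = i := by
  refine ⟨fun i j hij => ?_, fun v => ⟨c v, by simp⟩⟩
  rw [Finset.disjoint_left]
  intro v hi hj
  simp only [Finset.mem_filter, Finset.mem_univ, true_and] at hi hj
  exact hij (hi.symm.trans hj)

theorem cutCount_color_classes (G : SimpleGraph (Fin n)) [DecidableRel G.Adj] (c : Fin n → Fin r) :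
    cutCount G (fun i => Finset.univ.filter fun v => c v = i) =
      (G.edgeFinset ∩ crossPairs c).card := by
  rw [cutCount, Nat.card_coe_set_eq, ← Set.ncard_coe_finset]
  congr 1
  rw [Finset.coe_inter, SimpleGraph.coe_edgeFinset]
  congr 1
  ext e
  induction e with
  | _ u v =>
  rw [Finset.mem_coe, mk_mem_crossPairs]
  constructor
  · rintro ⟨a, b, hab, i, j, hij, ha, hb⟩
    simp at ha hb
    rcases Sym2.eq_iff.1 hab with ⟨rfl, rfl⟩ | ⟨rfl, rfl⟩
    · rwa [ha, hb]
    · rw [ha, hb]; exact hij.symm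
  · intro h
    exact ⟨u, v, rfl, c u, c v, h, by simp, by simp⟩

end Colorings

/-- A sample is typical with respect to a family of containers `x.2` with fingerprints `x.1` and
a colouring of each container. -/
structure IsTypical {n r : ℕ} (ω : Sym2 (Fin n) → Bool) (hr : 0 < r) (p s : ℝ)
    (𝒞 : Finset (Finset (Sym2 (Fin n)) × Finset (Sym2 (Fin n))))
    (col : Finset (Sym2 (Fin n)) → Fin n → Fin r) : Prop where
  proper_le : ∀ x ∈ 𝒞, (∀ e ∈ x.1, ω e = true) →
    (presentCount ω (properPairs x.2 \ x.1) : ℝ) ≤ p * (properPairs x.2 \ x.1).card + s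
  inner_le : ∀ x ∈ 𝒞, (∀ e ∈ x.1, ω e = true) →
    (presentCount ω (innerPairs (col x.2) x.2 \ x.1) : ℝ) ≤
      p * (innerPairs (col x.2) x.2 \ x.1).card + s
  le_residue : p * (crossPairs (residueColoring n hr)).card - s ≤
    presentCount ω (crossPairs (residueColoring n hr))
  cross_le : ∀ c : Fin n → Fin r,
    (presentCount ω (crossPairs c) : ℝ) ≤ p * (crossPairs c).card + s

theorem card_le_presentCount {α : Type*} {ω : α → Bool} {D E : Finset α} (hE : E ⊆ D)
    (hω : ∀ e ∈ E, ω e = true) : E.card ≤ presentCount ω D :=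
  Finset.card_le_card fun e he => Finset.mem_filter.2 ⟨hE he, hω e he⟩

/-- In a typical sample every largest `H`-free subgraph has only balanced maximum cuts. -/
theorem IsTypical.isBalancedCut {V : Type*} [Fintype V] {H : SimpleGraph V} {n r : ℕ}
    (hr : 0 < r) (hH : ¬ H.Colorable r) {ω : Sym2 (Fin n) → Bool} {p η δ : ℝ} (hp : 0 < p)
    (hδ : 0 < δ) (hηδ : 20 * η ≤ (δ / r) ^ 2) (hn : (n : ℝ) ≤ 2 * η * (n : ℝ) ^ 2)
    {𝒞 : Finset (Finset (Sym2 (Fin n)) × Finset (Sym2 (Fin n)))}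
    {col : Finset (Sym2 (Fin n)) → Fin n → Fin r}
    (hcover : ∀ I : Finset (Sym2 (Fin n)),
      injHoms H (SimpleGraph.fromEdgeSet (I : Set (Sym2 (Fin n)))) = ∅ →
      ∃ x ∈ 𝒞, x.1 ⊆ I ∧ I \ x.1 ⊆ x.2)
    (hsmall : ∀ x ∈ 𝒞, (x.1.card : ℝ) ≤ η * p * (n : ℝ) ^ 2)
    (hcol : ∀ x ∈ 𝒞, 2 * ((properPairs x.2).card : ℝ) + 2 * ((innerPairs (col x.2) x.2).card : ℝ) ≤
      (1 - 1 / (r : ℝ)) * (n : ℝ) ^ 2 + η * (n : ℝ) ^ 2)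
    (hω : IsTypical ω hr p (η * p * (n : ℝ) ^ 2) 𝒞 col)
    (F : SimpleGraph (Fin n)) (hF : F ≤ graphOf ω) (hfree : ¬ Contains H F)
    (hmax : ∀ F' : SimpleGraph (Fin n), F' ≤ graphOf ω → ¬ Contains H F' →
      Nat.card F'.edgeSet ≤ Nat.card F.edgeSet)
    (P : Fin r → Finset (Fin n)) (hP : IsCut P)
    (hPmax : ∀ P' : Fin r → Finset (Fin n), IsCut P' → cutCount F P' ≤ cutCount F P) :
    IsBalancedCut δ P := by
  classical
  set s := η * p * (n : ℝ) ^ 2 with hs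
  set I := F.edgeFinset with hI
  have hIF : SimpleGraph.fromEdgeSet (I : Set (Sym2 (Fin n))) = F := by
    rw [hI, SimpleGraph.coe_edgeFinset, SimpleGraph.fromEdgeSet_edgeSet]
  have hIω : ∀ e ∈ I, ω e = true := by
    intro e he
    have := SimpleGraph.edgeSet_mono hF (SimpleGraph.mem_edgeFinset.1 he)
    rw [graphOf, SimpleGraph.edgeSet_fromEdgeSet] at this
    exact this.1
  have hIdiag : ∀ e ∈ I, ¬ e.IsDiag := fun e he =>
    F.not_isDiag_of_mem_edgeSet (SimpleGraph.mem_edgeFinset.1 he)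
  obtain ⟨x, hx, hxI, hIx⟩ := hcover I (by
    rw [hIF, Finset.eq_empty_iff_forall_notMem]
    intro f hf
    rw [mem_injHoms] at hf
    exact hfree ⟨⟨f, fun h => hf.2 _ _ h⟩, hf.1⟩)
  have hxω : ∀ e ∈ x.1, ω e = true := fun e he => hIω e (hxI he)
  set c := col x.2 with hc
  have hsplit : ∀ J ⊆ I, J.card ≤ x.1.card + (J \ x.1).card := by
    intro J _
    have := Finset.card_le_card_sdiff_add_card (s := J) (t := x.1)
    omega
  have hIcard : (I.card : ℝ) ≤ s + (p * (properPairs x.2).card + s) := by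
    have h1 := hsplit I subset_rfl
    have h2 : (I \ x.1).card ≤ presentCount ω (properPairs x.2 \ x.1) := by
      refine card_le_presentCount (fun e he => ?_) fun e he => hIω e (Finset.mem_sdiff.1 he).1
      obtain ⟨heI, hex⟩ := Finset.mem_sdiff.1 he
      exact Finset.mem_sdiff.2 ⟨Finset.mem_filter.2 ⟨hIx he, hIdiag e heI⟩, hex⟩
    have h3 := hω.proper_le x hx hxω
    have h4 : ((properPairs x.2 \ x.1).card : ℝ) ≤ (properPairs x.2).card := by
      exact_mod_cast Finset.card_le_card Finset.sdiff_subset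
    have h5 := hsmall x hx
    have h6 : (I.card : ℝ) ≤ x.1.card + presentCount ω (properPairs x.2 \ x.1) := by
      exact_mod_cast h1.trans (by omega)
    nlinarith
  have hinner : ((innerPairs c I).card : ℝ) ≤ s + (p * (innerPairs c x.2).card + s) := by
    have h1 := hsplit (innerPairs c I) (Finset.filter_subset _ _)
    have h2 : (innerPairs c I \ x.1).card ≤ presentCount ω (innerPairs c x.2 \ x.1) := by
      refine card_le_presentCount (fun e he => ?_) fun e he =>
        hIω e (Finset.mem_filter.1 (Finset.mem_sdiff.1 he).1).1
      obtain ⟨heI, hex⟩ := Finset.mem_sdiff.1 he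
      obtain ⟨heI, hed⟩ := Finset.mem_filter.1 heI
      exact Finset.mem_sdiff.2 ⟨Finset.mem_filter.2
        ⟨hIx (Finset.mem_sdiff.2 ⟨heI, hex⟩), hed⟩, hex⟩
    have h3 := hω.inner_le x hx hxω
    rw [← hc] at h3
    have h4 : ((innerPairs c x.2 \ x.1).card : ℝ) ≤ (innerPairs c x.2).card := by
      exact_mod_cast Finset.card_le_card Finset.sdiff_subset
    have h5 := hsmall x hx
    have h6 : ((innerPairs c I).card : ℝ) ≤
        x.1.card + presentCount ω (innerPairs c x.2 \ x.1) := by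
      exact_mod_cast h1.trans (by omega)
    nlinarith
  have hcut : ((I ∩ crossPairs c).card : ℝ) + (innerPairs c I).card = I.card := by
    have h1 := Finset.card_filter_add_card_filter_not (s := I) (fun e => ¬ (Sym2.map c e).IsDiag)
    have h2 : I ∩ crossPairs c = I.filter fun e => ¬ (Sym2.map c e).IsDiag := by
      ext e; simp [crossPairs]
    have h3 : innerPairs c I = I.filter fun e => ¬ ¬ (Sym2.map c e).IsDiag := by
      refine Finset.filter_congr fun e he => ?_
      simp [hIdiag e he]
    rw [h2, h3]
    exact_mod_cast h1
  have hturan : p * (crossPairs (residueColoring n hr)).card - s ≤ I.card := by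
    refine hω.le_residue.trans ?_
    set T := (crossPairs (residueColoring n hr)).filter fun e => ω e = true with hT
    have hTadj : ∀ u v, (SimpleGraph.fromEdgeSet (T : Set (Sym2 (Fin n)))).Adj u v →
        residueColoring n hr u ≠ residueColoring n hr v ∧ ω s(u, v) = true := by
      intro u v h
      have := ((SimpleGraph.fromEdgeSet_adj _).1 h).1
      rw [Finset.mem_coe, hT, Finset.mem_filter, mk_mem_crossPairs] at this
      exact this
    have h1 := hmax (SimpleGraph.fromEdgeSet (T : Set (Sym2 (Fin n)))) (by
        intro u v h
        exact (SimpleGraph.fromEdgeSet_adj _).2 ⟨(hTadj u v h).2, h.ne⟩) (by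
        rintro ⟨f, _⟩
        exact hH ⟨SimpleGraph.Coloring.mk (fun v => residueColoring n hr (f v))
          fun h => (hTadj _ _ (f.map_adj h)).1⟩)
    have h2 : (SimpleGraph.fromEdgeSet (T : Set (Sym2 (Fin n)))).edgeSet = T := by
      rw [SimpleGraph.edgeSet_fromEdgeSet, sdiff_eq_left, Set.disjoint_left]
      intro e he hdiag
      induction e with
      | _ u v =>
      rw [Finset.mem_coe, hT, Finset.mem_filter, mk_mem_crossPairs] at he
      exact he.1 (congrArg _ (by simpa using hdiag))
    rw [h2, Nat.card_coe_set_eq, Set.ncard_coe_finset, Nat.card_coe_set_eq,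
      ← SimpleGraph.coe_edgeFinset, Set.ncard_coe_finset] at h1
    exact_mod_cast h1
  have hres := le_card_crossPairs_residueColoring (n := n) hr
  obtain ⟨g, rfl⟩ := exists_coloring_of_isCut hP
  have hle : ((I ∩ crossPairs c).card : ℝ) ≤ p * (crossPairs g).card + s := by
    have h1 := hPmax _ (isCut_color_classes c)
    rw [cutCount_color_classes, cutCount_color_classes] at h1
    have h2 : (I ∩ crossPairs g).card ≤ presentCount ω (crossPairs g) :=
      card_le_presentCount Finset.inter_subset_right fun e he =>
        hIω e (Finset.mem_inter.1 he).1
    refine le_trans ?_ (hω.cross_le g)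
    exact_mod_cast h1.trans h2
  have hr' : (0 : ℝ) < r := by exact_mod_cast hr
  have hlarge : (1 - 1 / (r : ℝ)) * (n : ℝ) ^ 2 - (δ * n / r) ^ 2 ≤
      2 * ((crossPairs g).card : ℝ) := by
    have h1 := hcol x hx
    rw [← hc] at h1
    have h2 := mul_le_mul_of_nonneg_left h1 hp.le
    have h3 := mul_le_mul_of_nonneg_left hres hp.le
    have h4 := mul_le_mul_of_nonneg_left hn hp.le
    have h5 : p * ((1 - 1 / (r : ℝ)) * (n : ℝ) ^ 2 - 20 * η * (n : ℝ) ^ 2) ≤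
        p * (2 * (crossPairs g).card) := by
      rw [hs] at *
      linarith
    have h6 := le_of_mul_le_mul_left h5 hp
    have h7 : 20 * η * (n : ℝ) ^ 2 ≤ (δ / r) ^ 2 * (n : ℝ) ^ 2 := by gcongr
    have h8 : (δ / r) ^ 2 * (n : ℝ) ^ 2 = (δ * n / r) ^ 2 := by ring
    linarith
  intro i
  have hfin := abs_le.1 (abs_card_color_class_sub_le hr g _ hlarge (by positivity) i)
  have h1 : (1 - δ) * n / r = (n : ℝ) / r - δ * n / r := by ring
  have h2 : (1 + δ) * n / r = (n : ℝ) / r + δ * n / r := by ring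
  rw [h1, h2]
  constructor <;> linarith [hfin.1, hfin.2]

theorem measureReal_biUnion_le {ι Ω : Type*} [MeasurableSpace Ω] (μ : Measure Ω)
    [IsFiniteMeasure μ] (s : Finset ι) (A : ι → Set Ω) (b : ι → ℝ)
    (h : ∀ i ∈ s, μ.real (A i) ≤ b i) : μ.real (⋃ i ∈ s, A i) ≤ ∑ i ∈ s, b i :=
  (measureReal_biUnion_finset_le s A).trans (Finset.sum_le_sum h)

section Deviation

variable {n : ℕ} {p η : ℝ}

theorem gnp_real_upper_le (h0 : 0 ≤ p) (h1 : p ≤ 1) (hη0 : 0 < η) (hη1 : η ≤ 1)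
    (S D : Finset (Sym2 (Fin n))) (hSD : Disjoint S D) :
    (gnp n p).real {ω | (∀ e ∈ S, ω e = true) ∧
        p * D.card + η * p * (n : ℝ) ^ 2 < presentCount ω D} ≤
      p ^ S.card * Real.exp (-(η ^ 2 * p * (n : ℝ) ^ 2 / 4)) := by
  have := isProbabilityMeasure_gnp n h0 h1
  have hD : (D.card : ℝ) ≤ (n : ℝ) ^ 2 :=
    le_trans (by exact_mod_cast Finset.card_le_univ D) (card_sym2_fin_le n)
  refine (measureReal_mono ?_).trans ((gnp_real_le h0 h1 S D hSD _ (η / 2)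
    (η / 2 * (η * p * (n : ℝ) ^ 2)) hD (by rw [abs_le]; constructor <;> linarith)).trans_eq ?_)
  · rintro ω ⟨hS, hω⟩
    exact ⟨hS, mul_le_mul_of_nonneg_left (by linarith) (by linarith)⟩
  · congr 2; ring

theorem gnp_real_lower_le (h0 : 0 ≤ p) (h1 : p ≤ 1) (hη0 : 0 < η) (hη1 : η ≤ 1)
    (D : Finset (Sym2 (Fin n))) :
    (gnp n p).real {ω | (presentCount ω D : ℝ) < p * D.card - η * p * (n : ℝ) ^ 2} ≤
      Real.exp (-(η ^ 2 * p * (n : ℝ) ^ 2 / 4)) := by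
  have := isProbabilityMeasure_gnp n h0 h1
  have hD : (D.card : ℝ) ≤ (n : ℝ) ^ 2 :=
    le_trans (by exact_mod_cast Finset.card_le_univ D) (card_sym2_fin_le n)
  refine (measureReal_mono ?_).trans ((gnp_real_le h0 h1 ∅ D (Finset.disjoint_empty_left D) _
    (-(η / 2)) (η / 2 * (η * p * (n : ℝ) ^ 2)) hD
    (by rw [abs_le]; constructor <;> linarith)).trans_eq ?_)
  · intro ω hω
    refine ⟨by simp, ?_⟩
    rw [neg_mul, ← mul_neg]
    refine mul_le_mul_of_nonneg_left ?_ (by linarith)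
    simp only [Set.mem_ofPred_eq] at hω
    linarith
  · rw [Finset.card_empty, pow_zero, one_mul]; congr 1; ring

/-- The union bound over all fingerprints. -/
theorem gnp_real_exists_upper_le (h0 : 0 ≤ p) (h1 : p ≤ 1) (hη0 : 0 < η) (hη1 : η ≤ 1)
    {L : ℕ} {s y : ℝ} (𝒞 : Finset (Finset (Sym2 (Fin n)) × Finset (Sym2 (Fin n))))
    (D : Finset (Sym2 (Fin n)) × Finset (Sym2 (Fin n)) → Finset (Sym2 (Fin n)))
    (hD : ∀ x, Disjoint x.1 (D x))
    (h𝒞 : ∀ y : ℝ, 0 ≤ y →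
      ∑ x ∈ 𝒞, y ^ x.1.card ≤ (1 + y) ^ (L * Fintype.card (Sym2 (Fin n))))
    (hsmall : ∀ x ∈ 𝒞, (x.1.card : ℝ) ≤ s) (hy0 : 0 < y) (hy1 : y ≤ 1)
    (hyL : y * L ≤ η ^ 2 / 16) (hys : s * Real.log (1 / y) ≤ η ^ 2 * p * (n : ℝ) ^ 2 / 16) :
    (gnp n p).real {ω | ∃ x ∈ 𝒞, (∀ e ∈ x.1, ω e = true) ∧
        p * (D x).card + η * p * (n : ℝ) ^ 2 < presentCount ω (D x)} ≤
      Real.exp (-(η ^ 2 * p * (n : ℝ) ^ 2 / 8)) := by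
  have := isProbabilityMeasure_gnp n h0 h1
  have hset : {ω | ∃ x ∈ 𝒞, (∀ e ∈ x.1, ω e = true) ∧
        p * (D x).card + η * p * (n : ℝ) ^ 2 < presentCount ω (D x)} =
      ⋃ x ∈ 𝒞, {ω | (∀ e ∈ x.1, ω e = true) ∧
        p * (D x).card + η * p * (n : ℝ) ^ 2 < presentCount ω (D x)} := by
    ext ω; simp only [Set.mem_iUnion, Set.mem_ofPred_eq, exists_prop]
  rw [hset]
  refine (measureReal_biUnion_le _ _ _ _ fun x _ =>
    gnp_real_upper_le h0 h1 hη0 hη1 x.1 (D x) (hD x)).trans ?_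
  rw [← Finset.sum_mul]
  have hpow : ∀ x ∈ 𝒞, p ^ x.1.card ≤
      Real.exp (η ^ 2 * p * (n : ℝ) ^ 2 / 16) * (y * p) ^ x.1.card := by
    intro x hx
    have hlog : 0 ≤ Real.log (1 / y) := Real.log_nonneg (by rw [le_div_iff₀ hy0]; linarith)
    have h2 : (1 / y) ^ x.1.card ≤ Real.exp (η ^ 2 * p * (n : ℝ) ^ 2 / 16) := by
      rw [← Real.exp_log (show 0 < 1 / y by positivity), ← Real.exp_nat_mul]
      exact Real.exp_le_exp.2 ((mul_le_mul_of_nonneg_right (hsmall x hx) hlog).trans hys)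
    calc p ^ x.1.card = (1 / y) ^ x.1.card * (y * p) ^ x.1.card := by
          rw [← mul_pow]; congr 1; field_simp
      _ ≤ _ := by gcongr
  have hsum : ∑ x ∈ 𝒞, (y * p) ^ x.1.card ≤ Real.exp (η ^ 2 * p * (n : ℝ) ^ 2 / 16) := by
    refine (h𝒞 (y * p) (by positivity)).trans ?_
    calc (1 + y * p) ^ (L * Fintype.card (Sym2 (Fin n))) ≤
        Real.exp (y * p) ^ (L * Fintype.card (Sym2 (Fin n))) := by
          gcongr
          linarith [Real.add_one_le_exp (y * p)]
      _ = Real.exp (y * L * (p * Fintype.card (Sym2 (Fin n)))) := by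
          rw [← Real.exp_nat_mul]; congr 1; push_cast; ring
      _ ≤ Real.exp (η ^ 2 / 16 * (p * (n : ℝ) ^ 2)) := by
          gcongr
          exact card_sym2_fin_le n
      _ = _ := by congr 1; ring
  calc (∑ x ∈ 𝒞, p ^ x.1.card) * Real.exp (-(η ^ 2 * p * (n : ℝ) ^ 2 / 4)) ≤
      (∑ x ∈ 𝒞, Real.exp (η ^ 2 * p * (n : ℝ) ^ 2 / 16) * (y * p) ^ x.1.card) *
        Real.exp (-(η ^ 2 * p * (n : ℝ) ^ 2 / 4)) := by
        gcongr with x hx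
        exact hpow x hx
    _ ≤ Real.exp (η ^ 2 * p * (n : ℝ) ^ 2 / 16) * Real.exp (η ^ 2 * p * (n : ℝ) ^ 2 / 16) *
        Real.exp (-(η ^ 2 * p * (n : ℝ) ^ 2 / 4)) := by
        rw [← Finset.mul_sum]
        gcongr
    _ = _ := by
        rw [← Real.exp_add, ← Real.exp_add]; congr 1; ring

theorem gnp_real_not_isTypical_le {r : ℕ} (hr : 0 < r) (h0 : 0 ≤ p) (h1 : p ≤ 1) (hη0 : 0 < η)
    (hη1 : η ≤ 1) {L : ℕ} {s y : ℝ}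
    (𝒞 : Finset (Finset (Sym2 (Fin n)) × Finset (Sym2 (Fin n))))
    (col : Finset (Sym2 (Fin n)) → Fin n → Fin r)
    (h𝒞 : ∀ y : ℝ, 0 ≤ y →
      ∑ x ∈ 𝒞, y ^ x.1.card ≤ (1 + y) ^ (L * Fintype.card (Sym2 (Fin n))))
    (hsmall : ∀ x ∈ 𝒞, (x.1.card : ℝ) ≤ s) (hy0 : 0 < y) (hy1 : y ≤ 1)
    (hyL : y * L ≤ η ^ 2 / 16) (hys : s * Real.log (1 / y) ≤ η ^ 2 * p * (n : ℝ) ^ 2 / 16) :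
    (gnp n p).real {ω | ¬ IsTypical ω hr p (η * p * (n : ℝ) ^ 2) 𝒞 col} ≤
      4 * ((r : ℝ) ^ n * Real.exp (-(η ^ 2 * p * (n : ℝ) ^ 2 / 8))) := by
  have := isProbabilityMeasure_gnp n h0 h1
  set A₁ := {ω | ∃ x ∈ 𝒞, (∀ e ∈ x.1, ω e = true) ∧
    p * (properPairs x.2 \ x.1).card + η * p * (n : ℝ) ^ 2 <
      presentCount ω (properPairs x.2 \ x.1)}
  set A₂ := {ω | ∃ x ∈ 𝒞, (∀ e ∈ x.1, ω e = true) ∧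
    p * (innerPairs (col x.2) x.2 \ x.1).card + η * p * (n : ℝ) ^ 2 <
      presentCount ω (innerPairs (col x.2) x.2 \ x.1)}
  set A₃ : Set (Sym2 (Fin n) → Bool) :=
    {ω | (presentCount ω (crossPairs (residueColoring n hr)) : ℝ) <
      p * (crossPairs (residueColoring n hr)).card - η * p * (n : ℝ) ^ 2}
  set A₄ : Set (Sym2 (Fin n) → Bool) := ⋃ c ∈ (Finset.univ : Finset (Fin n → Fin r)),
    {ω | (∀ e ∈ (∅ : Finset (Sym2 (Fin n))), ω e = true) ∧
      p * (crossPairs c).card + η * p * (n : ℝ) ^ 2 < presentCount ω (crossPairs c)}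
  have hsub : {ω | ¬ IsTypical ω hr p (η * p * (n : ℝ) ^ 2) 𝒞 col} ⊆ A₁ ∪ A₂ ∪ A₃ ∪ A₄ := by
    intro ω hω
    by_contra hno
    simp only [Set.mem_union, not_or] at hno
    obtain ⟨⟨⟨hA₁, hA₂⟩, hA₃⟩, hA₄⟩ := hno
    refine hω ⟨fun x hx hS => ?_, fun x hx hS => ?_, ?_, fun c => ?_⟩
    · exact not_lt.1 fun hlt => hA₁ ⟨x, hx, hS, hlt⟩
    · exact not_lt.1 fun hlt => hA₂ ⟨x, hx, hS, hlt⟩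
    · exact not_lt.1 fun hlt => hA₃ hlt
    · exact not_lt.1 fun hlt =>
        hA₄ (Set.mem_biUnion (Finset.mem_coe.2 (Finset.mem_univ c)) ⟨by simp, hlt⟩)
  set b := Real.exp (-(η ^ 2 * p * (n : ℝ) ^ 2 / 8)) with hb
  have hb0 : 0 ≤ b := (Real.exp_pos _).le
  have hb4 : Real.exp (-(η ^ 2 * p * (n : ℝ) ^ 2 / 4)) ≤ b := by
    refine Real.exp_le_exp.2 ?_
    have : 0 ≤ η ^ 2 * p * (n : ℝ) ^ 2 := by positivity
    linarith
  have hrn : (1 : ℝ) ≤ (r : ℝ) ^ n := one_le_pow₀ (by exact_mod_cast hr)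
  have e₁ : (gnp n p).real A₁ ≤ b := gnp_real_exists_upper_le h0 h1 hη0 hη1 𝒞
    (fun x => properPairs x.2 \ x.1) (fun x => Finset.disjoint_sdiff) h𝒞 hsmall hy0 hy1 hyL hys
  have e₂ : (gnp n p).real A₂ ≤ b := gnp_real_exists_upper_le h0 h1 hη0 hη1 𝒞
    (fun x => innerPairs (col x.2) x.2 \ x.1) (fun x => Finset.disjoint_sdiff) h𝒞 hsmall hy0 hy1
    hyL hys
  have e₃ : (gnp n p).real A₃ ≤ b := (gnp_real_lower_le h0 h1 hη0 hη1 _).trans hb4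
  have e₄ : (gnp n p).real A₄ ≤ (r : ℝ) ^ n * b := by
    refine (measureReal_biUnion_le _ _ _ (fun _ => b) fun c _ => ?_).trans_eq (by simp)
    refine (gnp_real_upper_le h0 h1 hη0 hη1 ∅ _ (Finset.disjoint_empty_left _)).trans ?_
    simpa using hb4
  have hbr : b ≤ (r : ℝ) ^ n * b := le_mul_of_one_le_left hb0 hrn
  calc _ ≤ (gnp n p).real (A₁ ∪ A₂ ∪ A₃ ∪ A₄) := measureReal_mono hsub
    _ ≤ (gnp n p).real A₁ + (gnp n p).real A₂ + (gnp n p).real A₃ + (gnp n p).real A₄ := by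
        have u₁ := measureReal_union_le (μ := gnp n p) A₁ A₂
        have u₂ := measureReal_union_le (μ := gnp n p) (A₁ ∪ A₂) A₃
        have u₃ := measureReal_union_le (μ := gnp n p) (A₁ ∪ A₂ ∪ A₃) A₄
        linarith
    _ ≤ _ := by linarith

end Deviation

/-- The edge sets of `H`-free graphs are covered by few containers, each with a
colouring for which the edges and the monochromatic edges together barely exceed the Turán bound. -/
theorem exists_containers_with_colorings {V : Type} [Fintype V] (H : SimpleGraph V) {r : ℕ}
    (hr : 0 < r) (hcol : H.Colorable (r + 1)) (hnb : ¬ H.Colorable 2) {η : ℝ} (hη : 0 < η) :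
    ∃ L : ℕ, ∀ᶠ n : ℕ in atTop,
      ∃ (𝒞 : Finset (Finset (Sym2 (Fin n)) × Finset (Sym2 (Fin n))))
        (col : Finset (Sym2 (Fin n)) → Fin n → Fin r),
        (∀ I : Finset (Sym2 (Fin n)),
          injHoms H (SimpleGraph.fromEdgeSet (I : Set (Sym2 (Fin n)))) = ∅ →
          ∃ x ∈ 𝒞, x.1 ⊆ I ∧ I \ x.1 ⊆ x.2) ∧
        (∀ x ∈ 𝒞, (x.1.card : ℝ) ≤ L * ((n : ℝ) ^ (-(1 / twoDensity H)) * (n : ℝ) ^ 2)) ∧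
        (∀ x ∈ 𝒞,
          2 * ((properPairs x.2).card : ℝ) + 2 * ((innerPairs (col x.2) x.2).card : ℝ) ≤
          (1 - 1 / (r : ℝ)) * (n : ℝ) ^ 2 + η * (n : ℝ) ^ 2) ∧
        ∀ y : ℝ, 0 ≤ y →
          ∑ x ∈ 𝒞, y ^ x.1.card ≤ (1 + y) ^ (L * Fintype.card (Sym2 (Fin n))) := by
  classical
  obtain ⟨d, rfl⟩ := Nat.exists_eq_succ_of_ne_zero hr.ne'
  obtain ⟨γ, hγ, n₀, hn₀⟩ := exists_coloring_of_card_injHoms_lt H d hcol η hη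
  have hH : 0 < H.edgeFinset.card := by
    obtain ⟨u, v, -, huv, -⟩ := exists_adj_adj_of_not_colorable_two H hnb
    exact Finset.card_pos.2 ⟨s(u, v), by simpa using huv⟩
  obtain ⟨L, hL⟩ := exists_containerCover_injHoms H hH (twoDensity H)
    (zero_lt_one.trans_le (one_le_twoDensity H hnb))
    (fun F hF hne => card_sub_one_le_twoDensity H hF hne) γ hγ
  refine ⟨L, ?_⟩
  filter_upwards [eventually_ge_atTop n₀, eventually_gt_atTop 0] with n hn hn0
  obtain ⟨𝒞, hcover, hQ, hsum⟩ := hL n hn0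
  have hex : ∀ C : Finset (Sym2 (Fin n)), ∃ c : Fin n → Fin (d + 1),
      ((injHoms H (SimpleGraph.fromEdgeSet (C : Set (Sym2 (Fin n))))).card : ℝ) <
        γ * (n : ℝ) ^ Fintype.card V →
      2 * ((properPairs C).card : ℝ) + 2 * ((innerPairs c C).card : ℝ) ≤
        (1 - 1 / ((d : ℝ) + 1)) * (n : ℝ) ^ 2 + η * (n : ℝ) ^ 2 := by
    intro C
    by_cases hC : ((injHoms H (SimpleGraph.fromEdgeSet (C : Set (Sym2 (Fin n))))).card : ℝ) <
        γ * (n : ℝ) ^ Fintype.card V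
    · obtain ⟨c, hc⟩ := hn₀ n hn _ hC
      rw [adjPairs_fromEdgeSet, monoPairs_fromEdgeSet] at hc
      exact ⟨c, fun _ => hc⟩
    · exact ⟨fun _ => 0, fun h => absurd h hC⟩
  choose col hcol' using hex
  refine ⟨𝒞, col, hcover, fun x hx => (hQ x hx).1, fun x hx => ?_, hsum⟩
  rw [Nat.cast_succ]
  exact hcol' _ (hQ x hx).2

theorem tendsto_log_natCast_rpow_atTop {a : ℝ} (ha : 0 < a) :
    Tendsto (fun n : ℕ => Real.log n ^ a) atTop atTop :=
  (tendsto_rpow_atTop ha).comp (Real.tendsto_log_atTop.comp tendsto_natCast_atTop_atTop)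

theorem eventually_mul_rpow_le {p : ℕ → ℝ} {a b c : ℝ} (hc : 0 < c) (hb : 0 < b)
    (hp : ∀ᶠ n : ℕ in atTop, c * (n : ℝ) ^ a * Real.log n ^ b ≤ p n) (K : ℝ) :
    ∀ᶠ n : ℕ in atTop, K * (n : ℝ) ^ a ≤ p n := by
  filter_upwards [hp, (tendsto_log_natCast_rpow_atTop hb).eventually_ge_atTop (K / c)] with n h1 h2
  refine le_trans ?_ h1
  rw [div_le_iff₀ hc] at h2
  nlinarith [Real.rpow_nonneg (Nat.cast_nonneg (α := ℝ) n) a]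

/-- Exponentially many events of superexponentially small probability are negligible. -/
theorem tendsto_pow_mul_exp_neg {p : ℕ → ℝ} {a : ℝ} (ha : 0 < a) {r : ℕ} (hr : 0 < r)
    (hp : ∀ K : ℝ, ∀ᶠ n : ℕ in atTop, K ≤ p n * n) :
    Tendsto (fun n : ℕ => 4 * ((r : ℝ) ^ n * Real.exp (-(a * p n * (n : ℝ) ^ 2)))) atTop (𝓝 0) := by
  have hlim : Tendsto (fun n : ℕ => 4 * Real.exp (-(n : ℝ))) atTop (𝓝 0) := by
    simpa using (Real.tendsto_exp_neg_atTop_nhds_zero.comp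
      (tendsto_natCast_atTop_atTop (R := ℝ))).const_mul 4
  refine squeeze_zero' (Eventually.of_forall fun n => by positivity) ?_ hlim
  filter_upwards [hp ((Real.log r + 1) / a)] with n hn
  rw [div_le_iff₀ ha] at hn
  rw [← Real.exp_log (show (0 : ℝ) < r by exact_mod_cast hr), ← Real.exp_nat_mul, ← Real.exp_add]
  gcongr
  nlinarith [Nat.cast_nonneg (α := ℝ) n]

theorem two_le_card_edgeSet_of_not_colorable_two {V : Type*} [Fintype V] {H : SimpleGraph V}
    (h : ¬ H.Colorable 2) : 2 ≤ Nat.card H.edgeSet := by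
  classical
  obtain ⟨u, v, w, huv, huw, hvw⟩ := exists_adj_adj_of_not_colorable_two H h
  rw [Nat.card_eq_fintype_card, ← SimpleGraph.edgeFinset_card]
  refine Finset.one_lt_card.2 ⟨s(u, v), by simpa using huv, s(u, w), by simpa using huw, ?_⟩
  exact fun heq => hvw (Sym2.congr_right.1 heq)

theorem tendsto_measure_one_of_compl {Ω : ℕ → Type*} [∀ n, MeasurableSpace (Ω n)]
    {μ : ∀ n, Measure (Ω n)} {A : ∀ n, Set (Ω n)} {f : ℕ → ℝ}
    (hμ : ∀ᶠ n in atTop, IsProbabilityMeasure (μ n)) (hA : ∀ n, MeasurableSet (A n))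
    (hB : ∀ᶠ n in atTop, (μ n).real (A n)ᶜ ≤ f n)
    (hf : Tendsto f atTop (𝓝 0)) : Tendsto (fun n => μ n (A n)) atTop (𝓝 1) := by
  have hlim : Tendsto (fun n => ENNReal.ofReal (1 - f n)) atTop (𝓝 1) := by
    simpa using ENNReal.tendsto_ofReal (hf.const_sub 1)
  refine tendsto_of_tendsto_of_tendsto_of_le_of_le' hlim tendsto_const_nhds ?_ ?_
  · filter_upwards [hμ, hB] with n h1 h2
    rw [probReal_compl_eq_one_sub (hA n)] at h2
    rw [← ofReal_measureReal]
    exact ENNReal.ofReal_le_ofReal (by linarith)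
  · filter_upwards [hμ] with n h1
    exact prob_le_one

theorem stmt18 {V : Type} [Fintype V] (H : SimpleGraph V) (r : ℕ)
    (hχ : H.chromaticNumber = (r : ℕ∞) + 1)
    (hnonbip : ¬ H.Colorable 2)
    (hcrit : EdgeCritical H)
    (hbal : StrictlyTwoBalanced H)
    (piH θ ε : ℝ)
    (hpi : Filter.Tendsto
      (fun m : ℕ => (copyCount H (KrmPlus r m) : ℝ) / (m : ℝ) ^ (Fintype.card V - 2))
      atTop (nhds piH))
    (hθpos : 0 < θ)
    (hθ : (r : ℝ) ^ ((2 : ℤ) - (Fintype.card V : ℤ)) * piH * θ ^ (Nat.card H.edgeSet - 1)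
        = 2 - 1 / twoDensity H)
    (hε : 0 < ε) (p : ℕ → ℝ)
    (hp : ∀ᶠ n : ℕ in atTop,
      (1 + ε) * θ * (n : ℝ) ^ (-(1 / twoDensity H)) *
          Real.log n ^ ((1 : ℝ) / ((Nat.card H.edgeSet : ℝ) - 1)) ≤ p n ∧ p n ≤ 1)
    (δ : ℝ) (hδ : 0 < δ) :
    Filter.Tendsto
      (fun n : ℕ => gnp n (p n)
        {ω | ∀ F : SimpleGraph (Fin n), F ≤ graphOf ω → ¬ Contains H F →
          (∀ F' : SimpleGraph (Fin n), F' ≤ graphOf ω → ¬ Contains H F' →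
            Nat.card F'.edgeSet ≤ Nat.card F.edgeSet) →
          ∀ P : Fin r → Finset (Fin n), IsCut P →
            (∀ P' : Fin r → Finset (Fin n), IsCut P' → cutCount F P' ≤ cutCount F P) →
            IsBalancedCut δ P})
      atTop (nhds 1) := by
  have hcol : H.Colorable (r + 1) :=
    SimpleGraph.chromaticNumber_le_iff_colorable.1 (by rw [hχ]; norm_cast)
  have hncol : ¬ H.Colorable r := by
    intro h
    have := SimpleGraph.chromaticNumber_le_iff_colorable.2 h
    rw [hχ] at this
    norm_cast at this
    omega
  have hr : 0 < r := by
    rcases Nat.eq_zero_or_pos r with rfl | hr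
    · exact absurd (hcol.mono (by norm_num)) hnonbip
    · exact hr
  classical
  have hm := one_le_twoDensity H hnonbip
  have hb : 0 < (1 : ℝ) / ((Nat.card H.edgeSet : ℝ) - 1) := by
    have : (2 : ℝ) ≤ Nat.card H.edgeSet := by
      exact_mod_cast two_le_card_edgeSet_of_not_colorable_two hnonbip
    exact one_div_pos.2 (by linarith)
  have hpge := eventually_mul_rpow_le (p := p) (mul_pos (by linarith : 0 < 1 + ε) hθpos) hb
    (hp.mono fun _ h => h.1)
  have hpn : ∀ K : ℝ, ∀ᶠ n : ℕ in atTop, K ≤ p n * n := by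
    intro K
    filter_upwards [hpge (max K 0), eventually_ge_atTop 1] with n h1 h2
    have hn : (1 : ℝ) ≤ n := by exact_mod_cast h2
    have h3 : (n : ℝ)⁻¹ ≤ (n : ℝ) ^ (-(1 / twoDensity H)) := by
      rw [← Real.rpow_neg_one]
      exact Real.rpow_le_rpow_of_exponent_le hn (neg_le_neg (div_le_one_of_le₀ hm (by linarith)))
    rw [← div_le_iff₀ (by linarith), div_eq_mul_inv]
    exact (mul_le_mul (le_max_left _ _) h3 (by positivity) (le_max_right _ _)).trans h1
  obtain ⟨η, hη0, hη1, hηδ⟩ : ∃ η : ℝ, 0 < η ∧ η ≤ 1 ∧ 20 * η ≤ (δ / r) ^ 2 :=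
    ⟨min 1 ((δ / r) ^ 2 / 20), by positivity, min_le_left _ _, by
      linarith [min_le_right 1 ((δ / r) ^ 2 / 20)]⟩
  obtain ⟨L, hL⟩ := exists_containers_with_colorings H hr hcol hnonbip hη0
  obtain ⟨y, hy0, hy1, hyL⟩ : ∃ y : ℝ, 0 < y ∧ y ≤ 1 ∧ y * L ≤ η ^ 2 / 16 := by
    refine ⟨η ^ 2 / 16 / (L + 1), by positivity, ?_, ?_⟩
    · rw [div_le_one (by positivity)]
      nlinarith [Nat.cast_nonneg (α := ℝ) L]
    · rw [div_mul_eq_mul_div, div_le_iff₀ (by positivity)]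
      nlinarith [sq_nonneg η]
  have htyp : ∀ᶠ n : ℕ in atTop, IsProbabilityMeasure (gnp n (p n)) ∧
      ∃ B : Set (Sym2 (Fin n) → Bool),
        (gnp n (p n)).real B ≤ 4 * ((r : ℝ) ^ n * Real.exp (-(η ^ 2 / 8 * p n * (n : ℝ) ^ 2))) ∧
        ∀ ω, ω ∉ B → ∀ F : SimpleGraph (Fin n), F ≤ graphOf ω → ¬ Contains H F →
          (∀ F' : SimpleGraph (Fin n), F' ≤ graphOf ω → ¬ Contains H F' →
            Nat.card F'.edgeSet ≤ Nat.card F.edgeSet) →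
          ∀ P : Fin r → Finset (Fin n), IsCut P →
            (∀ P' : Fin r → Finset (Fin n), IsCut P' → cutCount F P' ≤ cutCount F P) →
            IsBalancedCut δ P := by
    have hlin : ∀ᶠ n : ℕ in atTop, 1 / (2 * η) ≤ (n : ℝ) :=
      tendsto_natCast_atTop_atTop.eventually_ge_atTop _
    filter_upwards [hp, hL, hlin, hpge (L / η), hpge (L * Real.log (1 / y) * 16 / η ^ 2), hpn 1]
      with n hpn1 ⟨𝒞, col, hcover, hsmall, hcol𝒞, hsum⟩ hn2 hη3 hη4 hp1
    have hp0 : 0 < p n := by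
      by_contra! hneg
      nlinarith [Nat.cast_nonneg (α := ℝ) n]
    rw [div_mul_eq_mul_div, div_le_iff₀ hη0] at hη3
    rw [div_mul_eq_mul_div, div_le_iff₀ (by positivity)] at hη4
    rw [div_le_iff₀ (by positivity)] at hn2
    refine ⟨isProbabilityMeasure_gnp n hp0.le hpn1.2, _,
      (gnp_real_not_isTypical_le hr hp0.le hpn1.2 hη0 hη1 𝒞 col hsum hsmall hy0 hy1 hyL
        ?_).trans_eq ?_, fun ω hω => ?_⟩
    · nlinarith [mul_le_mul_of_nonneg_right hη4 (sq_nonneg (n : ℝ))]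
    · ring_nf
    · refine IsTypical.isBalancedCut hr hncol hp0 hδ hηδ ?_ hcover (fun x hx => ?_) hcol𝒞
        (not_not.1 hω)
      · nlinarith [Nat.cast_nonneg (α := ℝ) n]
      · refine (hsmall x hx).trans ?_
        nlinarith [mul_le_mul_of_nonneg_right hη3 (sq_nonneg (n : ℝ))]
  refine tendsto_measure_one_of_compl (htyp.mono fun _ h => h.1)
    (fun n => (Set.toFinite _).measurableSet) ?_
    (tendsto_pow_mul_exp_neg (by positivity : 0 < η ^ 2 / 8) hr hpn)
  filter_upwards [htyp] with n ⟨hprob, B, hB, hgood⟩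
  refine (measureReal_mono fun ω hω => ?_).trans hB
  by_contra h
  exact hω (hgood ω h)
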